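/- arXiv:math/9412223 — 4 statements merged into one kernel-verified Lean document; each statement's English description precedes it below -/
import Mathlib

section
/- Fix a dimension d. Let ε_ℝ be the supremum, over all lattices L in ℝ^d with B_{d,1} + L = ℝ^d, of the efficiency det(L)/vol(B_{d,1}), and for each positive integer k let ε_ℤ(k) be the maximum, over all finite-index subgroups L ≤ ℤ^d with S_{d,k} + L = ℤ^d, of the efficiency [ℤ^d : L]/|S_{d,k}|. Then ε_ℤ(k) = ε_ℝ + O(1/k) as k → ∞, i.e., there is a constant C with |ε_ℤ(k) − ε_ℝ| ≤ C/k for all k ≥ 1. The same statement holds with the simplex T_{d,1} in place of B_{d,1} and S'_{d,k} in place of S_{d,k}. -/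
open MeasureTheory
open scoped Pointwise

theorem mem_cl {d : ℕ} {R : Type*} [AddCommGroup R] (v : Fin d → R) (x : R) :
    x ∈ AddSubgroup.closure (Set.range v) ↔ ∃ c : Fin d → ℤ, ∑ i, c i • v i = x := by
  rw [← Submodule.span_int_eq_addSubgroupClosure, Submodule.mem_toAddSubgroup,
    Submodule.mem_span_range_iff_exists_fun]

theorem det_int_ge {d : ℕ} (v w : Fin d → Fin d → ℝ)
    (hw : ∀ i, w i ∈ AddSubgroup.closure (Set.range v)) (h0 : (Matrix.of w).det ≠ 0) :
    |(Matrix.of v).det| ≤ |(Matrix.of w).det| := by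
  choose M hM using fun i => (mem_cl v (w i)).1 (hw i)
  have h : Matrix.of w = (Matrix.of M).map (Int.castRingHom ℝ) * Matrix.of v := by
    ext i j
    rw [Matrix.of_apply, ← hM i]
    simp [Matrix.mul_apply, Finset.sum_apply]
  have h2 : ((Matrix.of M).map (Int.castRingHom ℝ)).det = ((Matrix.of M).det : ℝ) := by
    exact ((Int.castRingHom ℝ).map_det (Matrix.of M)).symm
  rw [h, Matrix.det_mul, h2] at h0 ⊢
  have h3 : (Matrix.of M).det ≠ 0 := by
    rintro h; simp [h] at h0
  have h4 : (1:ℝ) ≤ |((Matrix.of M).det : ℝ)| := by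
    exact_mod_cast Int.one_le_abs h3
  rw [abs_mul]
  nlinarith [abs_nonneg (Matrix.of v).det]

theorem coords {d : ℕ} (w : Fin d → Fin d → ℝ) (h0 : (Matrix.of w).det ≠ 0) (x : Fin d → ℝ) :
    ∃ c : Fin d → ℝ, ∑ i, c i • w i = x := by
  refine ⟨Matrix.vecMul x (Matrix.of w)⁻¹, ?_⟩
  have : Matrix.vecMul (Matrix.vecMul x (Matrix.of w)⁻¹) (Matrix.of w) = x := by
    rw [Matrix.vecMul_vecMul, Matrix.nonsing_inv_mul _ (isUnit_iff_ne_zero.2 h0), Matrix.vecMul_one]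
  conv_rhs => rw [← this]
  ext j
  simp [Matrix.vecMul_eq_sum, Finset.sum_apply]

theorem reduce {d : ℕ} (v : Fin d → Fin d → ℝ) (n : ℕ) : ∀ (w : Fin d → Fin d → ℝ) (C : ℝ),
    (∀ i, w i ∈ AddSubgroup.closure (Set.range v)) → (Matrix.of w).det ≠ 0 →
    |(Matrix.of w).det| < 2 ^ n * |(Matrix.of v).det| → 0 ≤ C → (∀ i j, |w i j| ≤ C) →
    ∃ u : Fin d → Fin d → ℝ,
      AddSubgroup.closure (Set.range u) = AddSubgroup.closure (Set.range v) ∧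
      (Matrix.of u).det ≠ 0 ∧ ∀ i j, |u i j| ≤ C * (d + 1) ^ n := by
  induction n with
  | zero =>
    intro w C hw h0 hlt
    have := det_int_ge v w hw h0
    simp at hlt; linarith
  | succ n ih =>
    intro w C hw h0 hlt hC hb
    have hd1 : (1:ℝ) ≤ d + 1 := by simp
    by_cases hall : ∀ i, v i ∈ AddSubgroup.closure (Set.range w)
    · refine ⟨w, le_antisymm ?_ ?_, h0, fun i j => (hb i j).trans ?_⟩
      · rw [AddSubgroup.closure_le]; rintro _ ⟨i, rfl⟩; exact hw i
      · rw [AddSubgroup.closure_le]; rintro _ ⟨i, rfl⟩; exact hall i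
      · exact le_mul_of_one_le_right hC (one_le_pow₀ hd1)
    · push Not at hall
      obtain ⟨i₀, hi₀⟩ := hall
      obtain ⟨c, hc⟩ := coords w h0 (v i₀)
      set f : Fin d → ℝ := fun i => c i - round (c i) with hf
      have hf2 : ∀ i, |f i| ≤ 1 / 2 := fun i => abs_sub_round _
      have hx : ∑ i, f i • w i = v i₀ - ∑ i, (round (c i)) • w i := by
        rw [← hc, ← Finset.sum_sub_distrib]
        refine Finset.sum_congr rfl fun i _ => ?_
        rw [hf]; simp only [sub_smul, Int.cast_smul_eq_zsmul]
      have hmem : ∑ i, (round (c i)) • w i ∈ AddSubgroup.closure (Set.range w) :=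
        (mem_cl _ _).2 ⟨_, rfl⟩
      have hex : ∃ i, f i ≠ 0 := by
        by_contra! hcon
        simp only [hcon, zero_smul, Finset.sum_const_zero] at hx
        rw [sub_eq_zero.1 hx.symm] at hi₀
        exact hi₀ hmem
      obtain ⟨i, hi⟩ := hex
      have hle : AddSubgroup.closure (Set.range w) ≤ AddSubgroup.closure (Set.range v) := by
        rw [AddSubgroup.closure_le]; rintro _ ⟨i, rfl⟩; exact hw i
      have hxm : ∑ i, f i • w i ∈ AddSubgroup.closure (Set.range v) := by
        rw [hx]
        exact sub_mem (AddSubgroup.subset_closure ⟨i₀, rfl⟩) (hle hmem)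
      have hdet : (Matrix.of (Function.update w i (∑ i, f i • w i))).det
          = f i * (Matrix.of w).det := by
        exact Matrix.det_updateRow_sum (Matrix.of w) i f
      have hxb : ∀ j, |(∑ i, f i • w i) j| ≤ C * (d + 1) := by
        intro j
        simp only [Finset.sum_apply, Pi.smul_apply, smul_eq_mul]
        refine (Finset.abs_sum_le_sum_abs _ _).trans ?_
        calc ∑ i, |f i * w i j| ≤ ∑ i : Fin d, C := by
              refine Finset.sum_le_sum fun i _ => ?_
              rw [abs_mul]
              nlinarith [hf2 i, hb i j, abs_nonneg (f i), abs_nonneg (w i j)]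
          _ ≤ C * (d + 1) := by simp; nlinarith
      obtain ⟨u, hu1, hu2, hu3⟩ := ih (Function.update w i (∑ i, f i • w i)) (C * (d + 1))
        (by
          intro k
          by_cases hk : k = i
          · subst hk; simpa using hxm
          · simpa [hk] using hw k)
        (by rw [hdet]; exact mul_ne_zero hi h0)
        (by
          rw [hdet, abs_mul]
          rw [pow_succ] at hlt
          nlinarith [hf2 i, abs_nonneg (f i), abs_nonneg (Matrix.of w).det])
        (by positivity)
        (by
          intro k j
          by_cases hk : k = i
          · subst hk; simpa using hxb j
          · simp only [Function.update_of_ne hk]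
            exact (hb k j).trans (le_mul_of_one_le_right hC hd1))
      exact ⟨u, hu1, hu2, fun i j => (hu3 i j).trans (by rw [pow_succ]; apply le_of_eq; ring)⟩

/-- a covering lattice contains a bounded independent tuple -/
theorem exists_indep {d : ℕ} (v : Fin d → Fin d → ℝ)
    (hcov : ∀ y : Fin d → ℝ, ∃ b : Fin d → ℝ, (∀ i, |b i| ≤ 1) ∧
      y - b ∈ AddSubgroup.closure (Set.range v)) :
    ∃ w : Fin d → Fin d → ℝ, (∀ i, w i ∈ AddSubgroup.closure (Set.range v)) ∧
      (Matrix.of w).det ≠ 0 ∧ ∀ i j, |w i j| ≤ d + 2 := by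
  choose b hb hm using hcov
  refine ⟨fun i => (Pi.single i ((d:ℝ) + 1)) - b (Pi.single i ((d:ℝ) + 1)), fun i => hm _, ?_, ?_⟩
  · apply det_ne_zero_of_sum_row_lt_diag
    intro i
    have h1 : ∑ j ∈ Finset.univ.erase i, ‖(Matrix.of (fun i => (Pi.single i ((d:ℝ) + 1)) - b (Pi.single i ((d:ℝ) + 1)))) i j‖ ≤ ∑ j ∈ Finset.univ.erase i, (1:ℝ) := by
      refine Finset.sum_le_sum fun j hj => ?_
      have hj' : j ≠ i := (Finset.mem_erase.1 hj).1
      simp only [Matrix.of_apply, Pi.sub_apply, Pi.single_eq_of_ne hj', zero_sub, norm_neg,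
        Real.norm_eq_abs]
      exact hb _ _
    refine h1.trans_lt ?_
    rw [Finset.sum_const, Finset.card_erase_of_mem (Finset.mem_univ _)]
    have hd : 1 ≤ d := i.pos
    simp only [Finset.card_univ, Fintype.card_fin, nsmul_eq_mul, mul_one, Matrix.of_apply,
      Pi.sub_apply, Pi.single_eq_same, Real.norm_eq_abs, Nat.cast_sub hd, Nat.cast_one]
    have := abs_le.1 (hb (Pi.single i ((d:ℝ) + 1)) i)
    refine lt_of_lt_of_le ?_ (le_abs_self _)
    linarith
  · intro i j
    have := abs_le.1 (hb (Pi.single i ((d:ℝ) + 1)) j)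
    have hd : (0:ℝ) ≤ d := by positivity
    by_cases hj : j = i
    · subst hj
      simp only [Pi.sub_apply, Pi.single_eq_same]
      rw [abs_le]; constructor <;> linarith
    · simp only [Pi.sub_apply, Pi.single_eq_of_ne hj]
      rw [abs_le]; constructor <;> linarith

theorem det_bd {d : ℕ} (A : Matrix (Fin d) (Fin d) ℝ) (C : ℝ) (h : ∀ i j, |A i j| ≤ C) :
    |A.det| ≤ d.factorial * C ^ d := by
  have := Matrix.det_le (A := A) (abv := AbsoluteValue.abs) (x := C) h
  simpa using this

theorem prod_diff {ι : Type*} (s : Finset ι) (a b : ι → ℝ) (M t : ℝ) (hM : 1 ≤ M) (ht : 0 ≤ t)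
    (ha : ∀ i, |a i| ≤ M) (hb : ∀ i, |b i| ≤ M) (hab : ∀ i, |a i - b i| ≤ t) :
    |∏ i ∈ s, a i - ∏ i ∈ s, b i| ≤ t * s.card * M ^ s.card := by
  classical
  induction s using Finset.induction_on with
  | empty => simp
  | insert i s hi ih =>
    rw [Finset.prod_insert hi, Finset.prod_insert hi, Finset.card_insert_of_notMem hi]
    have hp : |∏ i ∈ s, b i| ≤ M ^ s.card := by
      rw [Finset.abs_prod]
      rw [← Finset.prod_const]
      exact Finset.prod_le_prod (fun i _ => abs_nonneg _) fun i _ => hb i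
    have hMp : (1:ℝ) ≤ M ^ s.card := one_le_pow₀ hM
    have e : a i * ∏ i ∈ s, a i - b i * ∏ i ∈ s, b i =
      a i * (∏ i ∈ s, a i - ∏ i ∈ s, b i) + (a i - b i) * ∏ i ∈ s, b i := by ring
    rw [e]
    refine (abs_add_le _ _).trans ?_
    rw [abs_mul, abs_mul]
    have h1 : |a i| * |∏ i ∈ s, a i - ∏ i ∈ s, b i| ≤ M * (t * s.card * M ^ s.card) :=
      mul_le_mul (ha i) ih (abs_nonneg _) (by linarith)
    have h2 : |a i - b i| * |∏ i ∈ s, b i| ≤ t * M ^ s.card :=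
      mul_le_mul (hab i) hp (abs_nonneg _) ht
    have h3 : t * M ^ s.card ≤ t * (M * M ^ s.card) := by
      apply mul_le_mul_of_nonneg_left _ ht
      nlinarith
    push_cast
    rw [pow_succ]
    nlinarith

theorem det_near {d : ℕ} (F : Matrix (Fin d) (Fin d) ℝ) (D t : ℝ) (hD : 0 ≤ D)
    (ht : 0 ≤ t) (ht1 : t ≤ 1) (h : ∀ i j, |F i j| ≤ D) :
    1 - t * (d.factorial * (D * d * (1 + D) ^ d)) ≤ |(1 + t • F).det| := by
  have key : |(1 + t • F).det - (1 : Matrix (Fin d) (Fin d) ℝ).det| ≤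
      t * (d.factorial * (D * d * (1 + D) ^ d)) := by
    rw [Matrix.det_apply, Matrix.det_apply, ← Finset.sum_sub_distrib]
    refine (Finset.abs_sum_le_sum_abs _ _).trans ?_
    calc _ ≤ ∑ σ : Equiv.Perm (Fin d), (t * D) * d * (1 + D) ^ d := by
          refine Finset.sum_le_sum fun σ _ => ?_
          rw [← smul_sub]
          have : ∀ (z : ℤˣ) (x : ℝ), |z • x| = |x| := by
            intro z x
            rcases Int.units_eq_one_or z with rfl | rfl <;> simp
          rw [this]
          have h1 : ∀ i j, |(1 : Matrix (Fin d) (Fin d) ℝ) i j| ≤ 1 := by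
            intro i j; rw [Matrix.one_apply]; split_ifs <;> simp
          have h2 : ∀ i j, |t * F i j| ≤ t * D := by
            intro i j; rw [abs_mul, abs_of_nonneg ht]
            exact mul_le_mul_of_nonneg_left (h i j) ht
          have := prod_diff Finset.univ (fun i => (1 + t • F) (σ i) i)
            (fun i => (1 : Matrix (Fin d) (Fin d) ℝ) (σ i) i) (1 + D) (t * D) (by linarith)
            (by positivity) ?_ ?_ ?_
          · simpa using this
          · intro i
            simp only [Matrix.add_apply, Matrix.smul_apply, smul_eq_mul]
            refine (abs_add_le _ _).trans (add_le_add (h1 _ _) ((h2 _ _).trans ?_))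
            nlinarith
          · intro i; linarith [h1 (σ i) i]
          · intro i
            simp only [Matrix.add_apply, Matrix.smul_apply, smul_eq_mul, add_sub_cancel_left]
            exact h2 _ _
      _ = _ := by
          simp [Finset.card_univ, Fintype.card_perm]; ring
  rw [Matrix.det_one] at key
  have := abs_le.1 key
  have := le_abs_self (1 + t • F).det
  linarith

theorem inv_bd {d : ℕ} (A : Matrix (Fin d) (Fin d) ℝ) (C δ : ℝ) (hC : 1 ≤ C) (hδ : 0 < δ)
    (hA : ∀ i j, |A i j| ≤ C) (hdet : δ ≤ |A.det|) (i j : Fin d) :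
    |A⁻¹ i j| ≤ δ⁻¹ * (d.factorial * C ^ d) := by
  rw [Matrix.inv_def, Matrix.smul_apply, smul_eq_mul, abs_mul, Ring.inverse_eq_inv', abs_inv]
  refine mul_le_mul (inv_anti₀ hδ hdet) ?_ (abs_nonneg _) (by positivity)
  rw [Matrix.adjugate_apply]
  apply det_bd
  intro a b
  rw [Matrix.updateRow_apply]
  split_ifs
  · rw [Pi.single_apply]; split_ifs <;> simp <;> linarith
  · exact hA _ _

theorem index_closure {d : ℕ} (W : Fin d → Fin d → ℤ) (h0 : (Matrix.of W).det ≠ 0) :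
    (AddSubgroup.closure (Set.range W)).index = (Matrix.of W).det.natAbs := by
  have hli : LinearIndependent ℤ W := by
    exact Matrix.linearIndependent_rows_of_det_ne_zero (A := Matrix.of W) h0
  let b := Module.Basis.span hli
  have h := Submodule.natAbs_det_basis_change (Pi.basisFun ℤ (Fin d)) (Submodule.span ℤ (Set.range W)) b
  rw [← Submodule.span_int_eq_addSubgroupClosure]
  have e : ((↑) ∘ b : Fin d → Fin d → ℤ) = W := by
    ext1 i; simp [b, Module.Basis.span_apply]
  rw [e, Pi.basisFun_det_apply] at h
  exact h.symm

theorem exists_basis {d : ℕ} (L : AddSubgroup (Fin d → ℤ)) (h : L.index ≠ 0) :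
    ∃ W : Fin d → Fin d → ℤ, (Matrix.of W).det ≠ 0 ∧ AddSubgroup.closure (Set.range W) = L ∧
      L.index = (Matrix.of W).det.natAbs := by
  obtain ⟨e⟩ := Int.addSubgroup_index_ne_zero_iff.1 h
  let b : Module.Basis (Fin d) ℤ L.toIntSubmodule := Module.Basis.ofEquivFun e.toIntLinearEquiv
  have hi := AddSubgroup.index_eq_natAbs_det (Pi.basisFun ℤ (Fin d)) L b
  rw [Pi.basisFun_det_apply] at hi
  refine ⟨fun i => b i, ?_, ?_, hi⟩
  · intro hh
    rw [hi] at h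
    exact h (Int.natAbs_eq_zero.2 hh)
  · have := b.span_eq
    rw [← Submodule.span_int_eq_addSubgroupClosure]
    have h2 := congrArg (Submodule.map L.toIntSubmodule.subtype) this
    rw [Submodule.map_span, Submodule.map_top, Submodule.range_subtype, ← Set.range_comp] at h2
    have h3 := congrArg Submodule.toAddSubgroup h2
    simpa [Function.comp_def] using h3

structure Body (d : ℕ) (K : ℝ → Set (Fin d → ℝ)) (τ : Fin d → ℤ) (c : ℕ) : Prop where
  cpos : 1 ≤ c
  scale : ∀ a : ℝ, 0 < a → ∀ r x, x ∈ K r → a • x ∈ K (a * r)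
  thick : ∀ r : ℝ, 0 ≤ r → ∀ (n : ℕ) (x y : Fin d → ℝ), x ∈ K r → (∀ i, |y i - x i| ≤ n) →
    (fun i => y i + n * (τ i)) ∈ K (r + c * n)
  bdd : ∀ x ∈ K 1, ∀ i, |x i| ≤ 1
  zero : 0 ∈ K 0

namespace Body
variable {d : ℕ} {K : ℝ → Set (Fin d → ℝ)} {τ : Fin d → ℤ} {c : ℕ}

theorem vol_scale (B : Body d K τ c) (r : ℝ) (hr : 0 < r) :
    (volume (K r)).toReal = r ^ d * (volume (K 1)).toReal := by
  have : K r = r • K 1 := by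
    ext x
    rw [Set.mem_smul_set_iff_inv_smul_mem₀ hr.ne']
    constructor
    · intro h
      have := B.scale r⁻¹ (by positivity) r x h
      rwa [inv_mul_cancel₀ hr.ne'] at this
    · intro h
      have := B.scale r hr 1 _ h
      rwa [smul_inv_smul₀ hr.ne', mul_one] at this
  rw [this, Measure.addHaar_smul, ENNReal.toReal_mul, ENNReal.toReal_ofReal (abs_nonneg _)]
  simp [abs_of_pos hr]

theorem vol_fin (B : Body d K τ c) : volume (K 1) ≠ ⊤ := by
  have : K 1 ⊆ Metric.closedBall 0 1 := by
    intro x hx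
    rw [mem_closedBall_zero_iff, pi_norm_le_iff_of_nonneg zero_le_one]
    exact B.bdd x hx
  exact ((measure_mono this).trans_lt measure_closedBall_lt_top).ne

theorem vol_fin' (B : Body d K τ c) (r : ℝ) (hr : 0 < r) : volume (K r) ≠ ⊤ := by
  have : K r ⊆ Metric.closedBall 0 r := by
    intro x hx
    rw [mem_closedBall_zero_iff, pi_norm_le_iff_of_nonneg hr.le]
    intro i
    have h := B.scale r⁻¹ (by positivity) r x hx
    rw [inv_mul_cancel₀ hr.ne'] at h
    have := B.bdd _ h i
    rw [Pi.smul_apply, smul_eq_mul, abs_mul, abs_of_pos (by positivity : 0 < r⁻¹),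
      inv_mul_le_iff₀ hr, mul_one] at this
    exact this
  exact ((measure_mono this).trans_lt measure_closedBall_lt_top).ne

theorem vol_pos (B : Body d K τ c) : 0 < (volume (K 1)).toReal := by
  have hc : (0:ℝ) < c := by exact_mod_cast B.cpos
  have h1 : Metric.closedBall (fun i => (τ i : ℝ)) 1 ⊆ K c := by
    intro x hx
    rw [mem_closedBall_iff_norm, pi_norm_le_iff_of_nonneg zero_le_one] at hx
    have := B.thick 0 le_rfl 1 0 (fun i => x i - τ i) B.zero (by simpa using hx)
    simpa using this
  have h2 : 0 < (volume (K c)).toReal :=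
    ENNReal.toReal_pos ((Metric.measure_closedBall_pos _ _ one_pos).trans_le (measure_mono h1)).ne'
      (B.vol_fin' c hc)
  rw [B.vol_scale c hc] at h2
  exact pos_of_mul_pos_right h2 (by positivity)

theorem int_bdd (B : Body d K τ c) (k : ℕ) (hk : 1 ≤ k) (x : Fin d → ℤ)
    (hx : (fun i => (x i : ℝ)) ∈ K k) (i : Fin d) : |x i| ≤ k := by
  have hr : (0:ℝ) < k := by exact_mod_cast hk
  have h := B.scale (k:ℝ)⁻¹ (by positivity) k _ hx
  rw [inv_mul_cancel₀ hr.ne'] at h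
  have := B.bdd _ h i
  rw [Pi.smul_apply, smul_eq_mul, abs_mul, abs_of_pos (by positivity : 0 < (k:ℝ)⁻¹),
    inv_mul_le_iff₀ hr, mul_one] at this
  exact_mod_cast this

theorem finS (B : Body d K τ c) (k : ℕ) (hk : 1 ≤ k) :
    {x : Fin d → ℤ | (fun i => (x i : ℝ)) ∈ K k}.Finite := by
  refine (Set.finite_Icc (fun _ => -(k:ℤ)) (fun _ => (k:ℤ))).subset fun x hx => ?_
  exact ⟨fun i => (abs_le.1 (B.int_bdd k hk x hx i)).1, fun i => (abs_le.1 (B.int_bdd k hk x hx i)).2⟩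

def cube {d : ℕ} (s : Fin d → ℤ) : Set (Fin d → ℝ) :=
  Set.pi Set.univ fun i => Set.Ico (s i : ℝ) (s i + 1)

theorem mem_cube {d : ℕ} (s : Fin d → ℤ) (x : Fin d → ℝ) :
    x ∈ cube s ↔ ∀ i, ⌊x i⌋ = s i := by
  simp [cube, Int.floor_eq_iff]

theorem card_eq (B : Body d K τ c) (k : ℕ) (hk : 1 ≤ k) :
    volume (⋃ s ∈ (B.finS k hk).toFinset, cube s) =
      (Nat.card {x : Fin d → ℤ // (fun i => (x i : ℝ)) ∈ K k} : ENNReal) := by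
  rw [measure_biUnion_finset]
  · have : ∀ s : Fin d → ℤ, volume (cube s) = 1 := by
      intro s; simp [cube, Real.volume_pi_Ico]
    simp only [this]
    rw [Finset.sum_const, nsmul_eq_mul, mul_one]
    congr 1
    exact (Nat.card_eq_card_finite_toFinset (B.finS k hk)).symm
  · intro s _ t _ hst
    rw [Function.onFun, Set.disjoint_left]
    intro x hx hx'
    rw [mem_cube] at hx hx'
    exact hst (funext fun i => (hx i).symm.trans (hx' i))
  · intro s _
    exact MeasurableSet.univ_pi fun i => measurableSet_Ico

theorem card_upper (B : Body d K τ c) (k : ℕ) (hk : 1 ≤ k) :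
    (Nat.card {x : Fin d → ℤ // (fun i => (x i : ℝ)) ∈ K k} : ℝ) ≤
      (k + c : ℝ) ^ d * (volume (K 1)).toReal := by
  have hr : (0:ℝ) < k := by exact_mod_cast hk
  rw [← B.vol_scale (k + c) (by positivity)]
  have h : volume (⋃ s ∈ (B.finS k hk).toFinset, cube s) ≤ volume (K (k + c)) := by
    rw [← measure_preimage_add_right volume (fun i => (τ i : ℝ)) (K (k + c))]
    refine measure_mono fun x hx => ?_
    simp only [Set.mem_iUnion, Set.Finite.mem_toFinset, exists_prop] at hx
    obtain ⟨s, hs, hx⟩ := hx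
    have := B.thick k hr.le 1 _ x hs (fun i => by
      have h := hx i (Set.mem_univ _)
      rw [Nat.cast_one, abs_le]; constructor <;> linarith [h.1, h.2])
    simp only [Nat.cast_one, mul_one, one_mul] at this
    exact this
  rw [B.card_eq k hk] at h
  have := ENNReal.toReal_mono (B.vol_fin' (k + c) (by positivity)) h
  simpa using this

theorem card_lower (B : Body d K τ c) (hd : 1 ≤ d) (k : ℕ) (hk : 1 ≤ k) (hck : c ≤ k) :
    (k - c : ℝ) ^ d * (volume (K 1)).toReal ≤
    (Nat.card {x : Fin d → ℤ // (fun i => (x i : ℝ)) ∈ K k} : ℝ) := by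
  rcases hck.eq_or_lt with rfl | hlt
  · rw [sub_self, zero_pow (by omega)]; simp
  have hr : (0:ℝ) < k - c := by rw [sub_pos]; exact_mod_cast hlt
  rw [← B.vol_scale (k - c) hr]
  have h : volume (K (k - c)) ≤ volume (⋃ s ∈ (B.finS k hk).toFinset, cube s) := by
    rw [← measure_preimage_add_right volume (fun i => (τ i : ℝ)) (⋃ s ∈ _, cube s)]
    refine measure_mono fun x hx => ?_
    simp only [Set.mem_preimage, Set.mem_iUnion, Set.Finite.mem_toFinset, exists_prop]
    refine ⟨fun i => ⌊x i⌋ + τ i, ?_, ?_⟩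
    · have := B.thick (k - c) hr.le 1 x (fun i => ⌊x i⌋) hx (fun i => by
        rw [Nat.cast_one, abs_le]
        constructor <;> linarith [Int.floor_le (x i), Int.lt_floor_add_one (x i)])
      simp only [Nat.cast_one, mul_one, one_mul, sub_add_cancel] at this
      simpa using this
    · rw [mem_cube]; intro i; simp
  rw [B.card_eq k hk] at h
  have := ENNReal.toReal_mono (ENNReal.natCast_ne_top _) h
  simpa using this

theorem index_le (B : Body d K τ c) (k : ℕ) (hk : 1 ≤ k) (L : AddSubgroup (Fin d → ℤ))
    (hL : ∀ x : Fin d → ℤ, ∃ s : Fin d → ℤ, (fun i => (s i : ℝ)) ∈ K k ∧ x - s ∈ L) :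
    L.index ≤ Nat.card {x : Fin d → ℤ // (fun i => (x i : ℝ)) ∈ K k} := by
  have : Finite {x : Fin d → ℤ // (fun i => (x i : ℝ)) ∈ K k} := B.finS k hk
  refine Nat.card_le_card_of_surjective
    (fun s : {x : Fin d → ℤ // (fun i => (x i : ℝ)) ∈ K k} => (QuotientAddGroup.mk s.1 : _ ⧸ L)) ?_
  intro q
  obtain ⟨x, rfl⟩ := QuotientAddGroup.mk_surjective q
  obtain ⟨s, hs, hxs⟩ := hL x
  refine ⟨⟨s, hs⟩, ?_⟩
  rw [QuotientAddGroup.eq]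
  rwa [neg_add_eq_sub]

/-- from integer coverings to real coverings -/
theorem int_to_real (B : Body d K τ c) (k : ℕ) (hk : 1 ≤ k) (L : AddSubgroup (Fin d → ℤ))
    (h0 : L.index ≠ 0)
    (hL : ∀ x : Fin d → ℤ, ∃ s : Fin d → ℤ, (fun i => (s i : ℝ)) ∈ K k ∧ x - s ∈ L) :
    ∃ v : Fin d → (Fin d → ℝ), LinearIndependent ℝ v ∧
      (∀ y : Fin d → ℝ, ∃ b : Fin d → ℝ, b ∈ K 1 ∧ y - b ∈ AddSubgroup.closure (Set.range v)) ∧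
      |(Matrix.of v).det| * (k + c : ℝ) ^ d = L.index := by
  obtain ⟨W, hW, hWL, hind⟩ := exists_basis L h0
  have hr : (0:ℝ) < k + c := by have : (0:ℝ) < k := by exact_mod_cast hk
                                positivity
  set r : ℝ := k + c with hrdef
  set v : Fin d → Fin d → ℝ := fun i j => r⁻¹ * (W i j : ℝ) with hv
  have hmat : Matrix.of v = r⁻¹ • (Matrix.of W).map (Int.castRingHom ℝ) := by
    ext i j; simp [hv]
  have hdet : (Matrix.of v).det = (r⁻¹) ^ d * ((Matrix.of W).det : ℝ) := by
    rw [hmat, Matrix.det_smul, Fintype.card_fin]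
    congr 1
    exact ((Int.castRingHom ℝ).map_det (Matrix.of W)).symm
  refine ⟨v, ?_, ?_, ?_⟩
  · apply Matrix.linearIndependent_rows_of_det_ne_zero (A := Matrix.of v)
    rw [hdet]
    have : ((Matrix.of W).det : ℝ) ≠ 0 := by exact_mod_cast hW
    positivity
  · intro y
    obtain ⟨s, hs, hl⟩ := hL (fun i => ⌊r * y i - τ i⌋)
    rw [← hWL, mem_cl] at hl
    obtain ⟨z, hz⟩ := hl
    have hb := B.thick k (by positivity) 1 _ (fun i => s i + Int.fract (r * y i - τ i)) hs
      (fun i => by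
        rw [add_sub_cancel_left, Nat.cast_one, abs_of_nonneg (Int.fract_nonneg _)]
        exact (Int.fract_lt_one _).le)
    simp only [Nat.cast_one, mul_one, one_mul, ← hrdef] at hb
    have hb' := B.scale r⁻¹ (by positivity) _ _ hb
    rw [inv_mul_cancel₀ hr.ne'] at hb'
    refine ⟨_, hb', ?_⟩
    rw [mem_cl]
    refine ⟨z, ?_⟩
    ext j
    have hzj := congrFun hz j
    simp only [Finset.sum_apply, Pi.smul_apply, Pi.sub_apply, smul_eq_mul] at hzj
    have hzj' : ∑ i, (z i : ℝ) * (W i j : ℝ) = (⌊r * y j - τ j⌋ : ℝ) - s j := by exact_mod_cast hzj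
    simp only [Finset.sum_apply, Pi.smul_apply, Pi.sub_apply, smul_eq_mul, hv]
    simp only [zsmul_eq_mul]
    have : ∑ i, (z i : ℝ) * (r⁻¹ * (W i j : ℝ)) = r⁻¹ * ∑ i, (z i : ℝ) * (W i j : ℝ) := by
      rw [Finset.mul_sum]; refine Finset.sum_congr rfl fun i _ => by ring
    rw [this, hzj', Int.fract]
    field_simp
    ring
  · rw [hdet, hind, abs_mul, abs_of_pos (by positivity : (0:ℝ) < r⁻¹ ^ d), Nat.cast_natAbs,
      Int.cast_abs, inv_pow]
    field_simp

/-- from real coverings to integer coverings -/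
theorem real_to_int (B : Body d K τ c) (u : Fin d → Fin d → ℝ) (h0 : (Matrix.of u).det ≠ 0)
    (hcov : ∀ y : Fin d → ℝ, ∃ b : Fin d → ℝ, b ∈ K 1 ∧
      y - b ∈ AddSubgroup.closure (Set.range u))
    (D : ℝ) (hD0 : 0 ≤ D) (hD : ∀ i j, |(Matrix.of u)⁻¹ i j| ≤ D) (m : ℕ) (hm : d * (d * D) ≤ m)
    (C₁ : ℝ) (hC₁ : C₁ = d.factorial * ((d * D) * d * (1 + d * D) ^ d))
    (n : ℕ) (hn : 1 ≤ n) (hnC : C₁ < n) :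
    ∃ L : AddSubgroup (Fin d → ℤ), L.index ≠ 0 ∧
      (∀ x : Fin d → ℤ, ∃ s : Fin d → ℤ, (fun i => (s i : ℝ)) ∈ K (n + c * m) ∧ x - s ∈ L) ∧
      (n : ℝ) ^ d * |(Matrix.of u).det| * (1 - C₁ / n) ≤ L.index := by
  have hnpos : (0:ℝ) < n := by exact_mod_cast hn
  set W : Fin d → Fin d → ℤ := fun i j => round (n * u i j) with hW
  set WR : Matrix (Fin d) (Fin d) ℝ := (Matrix.of W).map (Int.castRingHom ℝ) with hWR
  set U : Matrix (Fin d) (Fin d) ℝ := Matrix.of u with hU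
  have hUu : IsUnit U.det := isUnit_iff_ne_zero.2 h0
  set E : Matrix (Fin d) (Fin d) ℝ := WR - (n:ℝ) • U with hE
  have hEb : ∀ i j, |E i j| ≤ 1 := by
    intro i j
    have : E i j = -((n * u i j) - round (n * u i j)) := by simp [hE, hWR, hW, hU]
    rw [this, abs_neg]
    exact (abs_sub_round _).trans (by norm_num)
  set F : Matrix (Fin d) (Fin d) ℝ := U⁻¹ * E with hF
  have hFb : ∀ i j, |F i j| ≤ d * D := by
    intro i j
    rw [hF, Matrix.mul_apply]
    refine (Finset.abs_sum_le_sum_abs _ _).trans ?_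
    calc _ ≤ ∑ _k : Fin d, D := by
          refine Finset.sum_le_sum fun k _ => ?_
          rw [abs_mul]
          nlinarith [hD i k, hEb k j, abs_nonneg (U⁻¹ i k), abs_nonneg (E k j)]
      _ = _ := by simp
  have hUF : U * F = E := by
    rw [hF, ← Matrix.mul_assoc, Matrix.mul_nonsing_inv _ hUu, Matrix.one_mul]
  have hWeq : WR = (n:ℝ) • (U * (1 + (n:ℝ)⁻¹ • F)) := by
    rw [Matrix.mul_add, Matrix.mul_one, Matrix.mul_smul, hUF, smul_add, smul_smul,
      mul_inv_cancel₀ hnpos.ne', one_smul, hE]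
    abel
  have hdetW : WR.det = ((Matrix.of W).det : ℝ) :=
    ((Int.castRingHom ℝ).map_det (Matrix.of W)).symm
  have hnear := det_near F (d * D) (n:ℝ)⁻¹ (by positivity) (by positivity)
    (inv_le_one_of_one_le₀ (by exact_mod_cast hn)) hFb
  rw [← hC₁, inv_mul_eq_div] at hnear
  have hpos1 : 0 < 1 - C₁ / n := by
    rw [sub_pos, div_lt_one hnpos]; exact hnC
  have hge : (n : ℝ) ^ d * |U.det| * (1 - C₁ / n) ≤ |WR.det| := by
    rw [hWeq, Matrix.det_smul, Matrix.det_mul, abs_mul, abs_mul, Fintype.card_fin,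
      abs_of_pos (by positivity : (0:ℝ) < n ^ d), mul_assoc]
    gcongr
  have hWpos : 0 < |WR.det| := by
    refine lt_of_lt_of_le ?_ hge
    have := abs_pos.2 h0
    positivity
  have hWR0 : WR.det ≠ 0 := abs_pos.1 hWpos
  have hW0 : (Matrix.of W).det ≠ 0 := by
    intro h; rw [hdetW, h] at hWR0; simp at hWR0
  have hidx := index_closure W hW0
  refine ⟨AddSubgroup.closure (Set.range W), ?_, ?_, ?_⟩
  · rw [hidx]; exact Int.natAbs_ne_zero.2 hW0
  · intro x
    set y : Fin d → ℝ := fun i => (x i : ℝ) - m * τ i with hy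
    set p := Matrix.vecMul y WR⁻¹ with hp
    obtain ⟨b, hb, hl⟩ := hcov (Matrix.vecMul p U)
    rw [mem_cl] at hl
    obtain ⟨z, hz⟩ := hl
    set zR : Fin d → ℝ := fun i => (z i : ℝ) with hzR
    have hz' : Matrix.vecMul zR U = Matrix.vecMul p U - b := by
      rw [← hz]; ext j; simp [Matrix.vecMul_eq_sum, hzR, hU]
    have hbF : b + Matrix.vecMul zR U = Matrix.vecMul p U := by rw [hz']; abel
    have hpy : Matrix.vecMul p WR = y := by
      rw [hp, Matrix.vecMul_vecMul, Matrix.nonsing_inv_mul _ (isUnit_iff_ne_zero.2 hWR0),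
        Matrix.vecMul_one]
    have hUW : WR = U * ((n:ℝ) • 1 + F) := by
      rw [Matrix.mul_add, hUF, Matrix.mul_smul, Matrix.mul_one, hE]; abel
    have hyeq : y = ((n:ℝ) • b + Matrix.vecMul b F) + Matrix.vecMul zR WR := by
      conv_lhs => rw [← hpy, hUW, ← Matrix.vecMul_vecMul, ← hbF, Matrix.add_vecMul,
        Matrix.vecMul_vecMul, ← hUW, Matrix.vecMul_add, Matrix.vecMul_smul, Matrix.vecMul_one]
    have hb1 := B.bdd b hb
    have hbF1 : ∀ j, |Matrix.vecMul b F j| ≤ m := by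
      intro j
      refine le_trans ?_ hm
      rw [Matrix.vecMul, dotProduct]
      refine (Finset.abs_sum_le_sum_abs _ _).trans ?_
      calc _ ≤ ∑ _k : Fin d, d * D := by
            refine Finset.sum_le_sum fun k _ => ?_
            rw [abs_mul]
            nlinarith [hb1 k, hFb k j, abs_nonneg (b k), abs_nonneg (F k j)]
        _ = _ := by simp
    have hnb := B.scale n hnpos 1 b hb
    rw [mul_one] at hnb
    have hth := B.thick n hnpos.le m _ ((n:ℝ) • b + Matrix.vecMul b F) hnb (fun i => by
      simpa using hbF1 i)
    refine ⟨fun j => x j - ∑ i, z i * W i j, ?_, ?_⟩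
    · convert hth using 2 with j
      have hj := congrFun hyeq j
      rw [Pi.add_apply] at hj
      have e : Matrix.vecMul zR WR j = ∑ i, (z i : ℝ) * (W i j : ℝ) := by
        simp [Matrix.vecMul, dotProduct, hzR, hWR]
      rw [e] at hj
      simp only [hy] at hj
      push_cast
      linarith
    · rw [mem_cl]
      refine ⟨z, ?_⟩
      ext j
      simp [Finset.sum_apply]
  · rw [hidx, Nat.cast_natAbs, Int.cast_abs, ← hdetW]; exact hge

/-- determinant bound for covering lattices and uniformly good bases -/
theorem det_le_of_cov (B : Body d K τ c) (v : Fin d → Fin d → ℝ)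
    (hcov : ∀ y : Fin d → ℝ, ∃ b : Fin d → ℝ, b ∈ K 1 ∧
      y - b ∈ AddSubgroup.closure (Set.range v)) :
    |(Matrix.of v).det| ≤ d.factorial * ((d:ℝ) + 2) ^ d := by
  obtain ⟨w, hw, hw0, hwb⟩ := exists_indep v (fun y => by
    obtain ⟨b, hb, h⟩ := hcov y; exact ⟨b, B.bdd b hb, h⟩)
  exact (det_int_ge v w hw hw0).trans (det_bd _ _ hwb)

theorem good_basis (B : Body d K τ c) (δ : ℝ) (hδ : 0 < δ) : ∃ D : ℝ, 0 ≤ D ∧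
    ∀ v : Fin d → Fin d → ℝ, δ ≤ |(Matrix.of v).det| →
    (∀ y : Fin d → ℝ, ∃ b : Fin d → ℝ, b ∈ K 1 ∧ y - b ∈ AddSubgroup.closure (Set.range v)) →
    ∃ u : Fin d → Fin d → ℝ,
      AddSubgroup.closure (Set.range u) = AddSubgroup.closure (Set.range v) ∧
      (Matrix.of u).det ≠ 0 ∧ |(Matrix.of v).det| ≤ |(Matrix.of u).det| ∧
      ∀ i j, |(Matrix.of u)⁻¹ i j| ≤ D := by
  obtain ⟨n, hn⟩ := pow_unbounded_of_one_lt (d.factorial * ((d:ℝ) + 2) ^ d / δ) (one_lt_two)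
  have h2 : (1:ℝ) ≤ ((d:ℝ) + 2) * (d + 1) ^ n := by
    have h1 : (1:ℝ) ≤ (d + 1) ^ n := one_le_pow₀ (by simp)
    have : (0:ℝ) ≤ d := by positivity
    nlinarith
  refine ⟨δ⁻¹ * (d.factorial * (((d:ℝ) + 2) * (d + 1) ^ n) ^ d), by positivity, ?_⟩
  intro v hv hcov
  obtain ⟨w, hw, hw0, hwb⟩ := exists_indep v (fun y => by
    obtain ⟨b, hb, h⟩ := hcov y; exact ⟨b, B.bdd b hb, h⟩)
  have hlt : |(Matrix.of w).det| < 2 ^ n * |(Matrix.of v).det| := by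
    have h1 := det_bd (Matrix.of w) _ hwb
    rw [div_lt_iff₀ hδ] at hn
    have : (2:ℝ) ^ n * δ ≤ 2 ^ n * |(Matrix.of v).det| := by gcongr
    linarith
  obtain ⟨u, hu1, hu2, hu3⟩ := reduce v n w _ hw hw0 hlt (by positivity) hwb
  have hvu : |(Matrix.of v).det| ≤ |(Matrix.of u).det| := by
    apply det_int_ge v u _ hu2
    intro i; rw [← hu1]; exact AddSubgroup.subset_closure ⟨i, rfl⟩
  exact ⟨u, hu1, hu2, hvu, fun i j => inv_bd _ _ δ h2 hδ hu3 (hv.trans hvu) i j⟩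

theorem bern (d : ℕ) (x y : ℝ) (hx : 0 ≤ x) (hxy : x ≤ y) (hy : 0 < y) :
    1 - d * ((y - x) / y) ≤ (x / y) ^ d := by
  have h := one_add_mul_le_pow (a := -((y - x) / y)) (by
    have : (y - x) / y ≤ 1 := by rw [div_le_one hy]; linarith
    linarith) d
  have e : 1 + -((y - x) / y) = x / y := by field_simp; ring
  rw [e] at h
  linarith

set_option maxHeartbeats 1000000 in
theorem main (B : Body d K τ c) (hd : 1 ≤ d) (Q : ℕ → (Fin d → ℤ) → Prop)
    (hQ : ∀ k x, Q k x ↔ (fun i => (x i : ℝ)) ∈ K k) :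
    ∃ C : ℝ, ∀ k : ℕ, 1 ≤ k →
      |sSup {e : ℝ | ∃ L : AddSubgroup (Fin d → ℤ), L.index ≠ 0 ∧
            (∀ x : Fin d → ℤ, ∃ s : Fin d → ℤ, Q k s ∧ x - s ∈ L) ∧
            e = (L.index : ℝ) / (Nat.card {x : Fin d → ℤ // Q k x} : ℝ)} -
        sSup {e : ℝ | ∃ v : Fin d → (Fin d → ℝ), LinearIndependent ℝ v ∧
            (∀ y : Fin d → ℝ, ∃ b : Fin d → ℝ, b ∈ K 1 ∧
              y - b ∈ AddSubgroup.closure (Set.range v)) ∧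
            e = |(Matrix.of v).det| / (volume (K 1)).toReal}| ≤ C / k := by
  simp only [hQ]
  set V := (volume (K 1)).toReal with hV
  have hVpos : 0 < V := B.vol_pos
  set SR : Set ℝ := {e : ℝ | ∃ v : Fin d → (Fin d → ℝ), LinearIndependent ℝ v ∧
            (∀ y : Fin d → ℝ, ∃ b : Fin d → ℝ, b ∈ K 1 ∧
              y - b ∈ AddSubgroup.closure (Set.range v)) ∧
            e = |(Matrix.of v).det| / V} with hSR
  set M : ℝ := d.factorial * ((d:ℝ) + 2) ^ d / V with hM
  have hSRM : ∀ e ∈ SR, e ≤ M := by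
    rintro e ⟨v, -, hcov, rfl⟩
    exact div_le_div_of_nonneg_right (B.det_le_of_cov v hcov) hVpos.le
  have hbdd : BddAbove SR := ⟨M, hSRM⟩
  have hSR0 : 0 ≤ sSup SR := Real.sSup_nonneg (by rintro e ⟨v, -, -, rfl⟩; positivity)
  have hc1 : (1:ℝ) ≤ c := by exact_mod_cast B.cpos
  have hd1 : (1:ℝ) ≤ d := by exact_mod_cast hd
  set SZ : ℕ → Set ℝ := fun k => {e : ℝ | ∃ L : AddSubgroup (Fin d → ℤ), L.index ≠ 0 ∧
            (∀ x : Fin d → ℤ, ∃ s : Fin d → ℤ, (fun i => (s i : ℝ)) ∈ K k ∧ x - s ∈ L) ∧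
            e = (L.index : ℝ) / (Nat.card {x : Fin d → ℤ // (fun i => (x i : ℝ)) ∈ K k} : ℝ)} with hSZ
  have hSZ1 : ∀ k, 1 ≤ k → ∀ e ∈ SZ k, e ≤ 1 := by
    rintro k hk e ⟨L, -, hL, rfl⟩
    exact div_le_one_of_le₀ (by exact_mod_cast B.index_le k hk L hL) (by positivity)
  have hSZ0 : ∀ k, 0 ≤ sSup (SZ k) := fun k =>
    Real.sSup_nonneg (by rintro e ⟨v, -, -, rfl⟩; positivity)
  -- upper bound
  have hup : ∀ k : ℕ, 1 ≤ k → sSup (SZ k) ≤ sSup SR + d * (2 * c) / k := by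
    intro k hk
    have hkpos : (0:ℝ) < k := by exact_mod_cast hk
    refine Real.sSup_le ?_ (by positivity)
    intro e he
    have he1 := hSZ1 k hk e he
    by_cases hck : c ≤ k
    · obtain ⟨L, hL0, hL, rfl⟩ := he
      set N : ℝ := (Nat.card {x : Fin d → ℤ // (fun i => (x i : ℝ)) ∈ K k} : ℝ) with hN
      have hck' : (c:ℝ) ≤ k := by exact_mod_cast hck
      have hlow : (k - c : ℝ) ^ d * V ≤ N := B.card_lower hd k hk hck
      obtain ⟨v, hv1, hv2, hv3⟩ := B.int_to_real k hk L hL0 hL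
      have hvE : |(Matrix.of v).det| / V ≤ sSup SR := le_csSup hbdd ⟨v, hv1, hv2, rfl⟩
      rw [div_le_iff₀ hVpos] at hvE
      have hidx : (L.index : ℝ) ≤ sSup SR * V * (k + c) ^ d := by
        rw [← hv3]; gcongr
      have he0 : 0 ≤ (L.index : ℝ) / N := by positivity
      have h1 : (L.index : ℝ) / N * ((k - c : ℝ) ^ d * V) ≤ sSup SR * V * (k + c) ^ d := by
        refine le_trans (mul_le_mul_of_nonneg_left hlow he0) (le_trans ?_ hidx)
        rw [div_mul_eq_mul_div]
        exact div_le_of_le_mul₀ (by positivity) (by positivity) le_rfl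
      have h2 : (L.index : ℝ) / N * ((k - c : ℝ) / (k + c)) ^ d ≤ sSup SR := by
        rw [div_pow, ← mul_div_assoc, div_le_iff₀ (by positivity)]
        nlinarith
      have hb := bern d (k - c) (k + c) (by linarith) (by linarith) (by positivity)
      have h3 : (d:ℝ) * ((k + c - (k - c)) / (k + c)) ≤ d * (2 * c) / k := by
        rw [mul_div_assoc]
        have : (k + c - (k - c) : ℝ) = 2 * c := by ring
        rw [this]
        gcongr
        linarith
      have h4 : (L.index : ℝ) / N * (1 - d * (2 * c) / k) ≤ sSup SR := by
        refine le_trans (mul_le_mul_of_nonneg_left ?_ he0) h2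
        linarith
      have h5 : 0 ≤ (d:ℝ) * (2 * c) / k := by positivity
      nlinarith
    · have : (1:ℝ) ≤ d * (2 * c) / k := by
        rw [le_div_iff₀ hkpos]
        have : (k:ℝ) ≤ c := by exact_mod_cast (not_le.1 hck).le
        nlinarith
      linarith
  -- lower bound
  have hlo : ∃ C : ℝ, 0 ≤ C ∧ ∀ k : ℕ, 1 ≤ k → sSup SR ≤ sSup (SZ k) + C / k := by
    rcases hSR0.eq_or_lt with h0 | hpos
    · exact ⟨0, le_rfl, fun k _ => by rw [← h0]; simpa using hSZ0 k⟩
    obtain ⟨D, hD0, hD⟩ := B.good_basis (sSup SR / 2 * V) (by positivity)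
    obtain ⟨m, hm⟩ := exists_nat_ge ((d:ℝ) * (d * D))
    set C₁ : ℝ := d.factorial * ((d * D) * d * (1 + d * D) ^ d) with hC₁
    have hC₁0 : 0 ≤ C₁ := by positivity
    obtain ⟨n₁, hn₁⟩ := exists_nat_gt C₁
    have hM0 : 0 ≤ M := by positivity
    -- k₀ threshold
    set k₀ : ℕ := 2 * (c * m) + 2 * n₁ + 2 with hk₀
    refine ⟨M * k₀ + M * (d * (c * m + c) + 2 * C₁), by positivity, fun k hk => ?_⟩
    have hkpos : (0:ℝ) < k := by exact_mod_cast hk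
    refine le_of_forall_lt fun a ha => ?_
    obtain ⟨e, he, hae⟩ := exists_lt_of_lt_csSup
      (by by_contra hne; rw [Set.not_nonempty_iff_eq_empty] at hne; rw [hne] at hpos; simp at hpos)
      (max_lt ha (half_lt_self hpos))
    refine lt_of_lt_of_le ((le_max_left _ _).trans_lt hae) ?_
    have heM := hSRM e he
    have he2 := ((le_max_right _ _).trans_lt hae)
    have he0 : 0 ≤ e := by linarith
    have hsplit : (M * k₀ + M * (d * (c * m + c) + 2 * C₁)) / k =
      M * k₀ / k + M * (d * (c * m + c) + 2 * C₁) / k := by rw [add_div]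
    have t1 : 0 ≤ M * k₀ / k := by positivity
    have t2 : 0 ≤ M * (d * (c * m + c) + 2 * C₁) / k := by positivity
    rw [hsplit]
    by_cases hkk : k < k₀
    · have : M ≤ M * k₀ / k := by
        rw [le_div_iff₀ hkpos]
        have : (k:ℝ) ≤ k₀ := by exact_mod_cast hkk.le
        gcongr
      linarith [hSZ0 k]
    · push Not at hkk
      obtain ⟨n, hn⟩ : ∃ n, k = n + c * m := ⟨k - c * m, by omega⟩
      have hn1 : 1 ≤ n := by omega
      have hnn : n₁ ≤ n := by omega
      have hn2 : k ≤ 2 * n := by omega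
      have hnpos : (0:ℝ) < n := by exact_mod_cast hn1
      have hnn' : (n₁:ℝ) ≤ n := by exact_mod_cast hnn
      have hn2' : (k:ℝ) ≤ 2 * n := by exact_mod_cast hn2
      have hkn : (k:ℝ) = n + c * m := by rw [hn]; push_cast; ring
      obtain ⟨v, -, hcov, rfl⟩ := he
      obtain ⟨u, hu1, hu2, hu3, hu4⟩ := hD v
        (by rw [lt_div_iff₀ hVpos] at he2; exact he2.le) hcov
      obtain ⟨L, hL0, hL, hLi⟩ := B.real_to_int u hu2 (by rw [hu1]; exact hcov) D hD0 hu4 m hm C₁ hC₁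
        n hn1 (by linarith)
      rw [← hkn] at hL
      have hmem : (L.index : ℝ) / (Nat.card {x : Fin d → ℤ // (fun i => (x i : ℝ)) ∈ K k} : ℝ) ≤
        sSup (SZ k) := le_csSup ⟨1, hSZ1 k hk⟩ ⟨L, hL0, hL, rfl⟩
      set N : ℝ := (Nat.card {x : Fin d → ℤ // (fun i => (x i : ℝ)) ∈ K k} : ℝ) with hN
      have hNpos : 0 < N := by
        have := B.index_le k hk L hL
        rw [hN]; exact_mod_cast (Nat.pos_of_ne_zero hL0).trans_le this
      have hNup : N ≤ (k + c : ℝ) ^ d * V := B.card_upper k hk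
      set e := |(Matrix.of v).det| / V with he
      have hq : 0 ≤ 1 - C₁ / n := by
        rw [sub_nonneg, div_le_one hnpos]; linarith
      have h1 : (n:ℝ) ^ d * (e * V) * (1 - C₁ / n) ≤ L.index := by
        refine le_trans ?_ hLi
        have : e * V = |(Matrix.of v).det| := by rw [he]; field_simp
        rw [this]; gcongr
      have h2 : e * ((n / (k + c) : ℝ) ^ d * (1 - C₁ / n)) ≤ sSup (SZ k) := by
        refine le_trans ?_ hmem
        rw [le_div_iff₀ hNpos]
        refine le_trans (mul_le_mul_of_nonneg_left hNup (by positivity)) (le_trans (le_of_eq ?_) h1)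
        rw [div_pow]
        have : ((k:ℝ) + c) ^ d ≠ 0 := by positivity
        field_simp
      have hcm : (0:ℝ) ≤ c * m := by positivity
      have hb := bern d n (k + c) hnpos.le (by linarith) (by positivity)
      have hx : (d:ℝ) * ((k + c - n) / (k + c)) ≤ d * (c * m + c) / k := by
        rw [mul_div_assoc]
        have : (k + c - n : ℝ) = c * m + c := by rw [hkn]; ring
        rw [this]
        gcongr
        linarith
      have hy : C₁ / n ≤ 2 * C₁ / k := by
        rw [div_le_div_iff₀ hnpos hkpos]
        have := mul_le_mul_of_nonneg_left hn2' hC₁0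
        linarith
      have hx0 : 0 ≤ (d:ℝ) * (c * m + c) / k := by positivity
      have hy0 : 0 ≤ C₁ / n := by positivity
      have h3 : 1 - d * (c * m + c) / k - 2 * C₁ / k ≤ (n / (k + c) : ℝ) ^ d * (1 - C₁ / n) := by
        have : (1 - d * (c * m + c) / k) * (1 - C₁ / n) ≤ (n / (k + c) : ℝ) ^ d * (1 - C₁ / n) :=
          mul_le_mul_of_nonneg_right (by linarith) hq
        have h7 := mul_nonneg hx0 hy0
        have h8 : (1 - d * (c * m + c) / k) * (1 - C₁ / n) = 1 - d * (c * m + c) / k - C₁ / n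
            + d * (c * m + c) / k * (C₁ / n) := by ring
        linarith
      have h4 := mul_le_mul_of_nonneg_left h3 he0
      have h5 : e * (d * (c * m + c) / k + 2 * C₁ / k) ≤ M * (d * (c * m + c) / k + 2 * C₁ / k) := by
        apply mul_le_mul_of_nonneg_right heM; positivity
      have h6 : M * (d * (c * m + c) + 2 * C₁) / k = M * (d * (c * m + c) / k + 2 * C₁ / k) := by
        ring
      rw [h6]
      have h9 : e * (1 - d * (c * m + c) / k - 2 * C₁ / k) =
        e - e * (d * (c * m + c) / k + 2 * C₁ / k) := by ring
      linarith
  obtain ⟨C, hC0, hC⟩ := hlo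
  refine ⟨C + d * (2 * c), fun k hk => ?_⟩
  have hkpos : (0:ℝ) < k := by exact_mod_cast hk
  have h1 := hup k hk
  have h2 := hC k hk
  have h3 : 0 ≤ C / k := by positivity
  have h4 : 0 ≤ (d:ℝ) * (2 * c) / k := by positivity
  change |sSup (SZ k) - sSup SR| ≤ _
  rw [add_div, abs_le]
  constructor <;> linarith

end Body

theorem bodyB (d : ℕ) (hd : 1 ≤ d) :
    Body d (fun r => {x : Fin d → ℝ | (∑ i, |x i|) ≤ r}) 0 d where
  cpos := hd
  scale := by
    intro a ha r x hx
    simp only [Set.mem_ofPred_eq, Pi.smul_apply, smul_eq_mul, abs_mul, abs_of_pos ha,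
      ← Finset.mul_sum] at hx ⊢
    gcongr
  thick := by
    intro r hr n x y hx hy
    simp only [Set.mem_ofPred_eq, Pi.zero_apply, Int.cast_zero, mul_zero, add_zero] at hx ⊢
    calc ∑ i, |y i| ≤ ∑ i, (|x i| + n) := by
          refine Finset.sum_le_sum fun i _ => ?_
          have := abs_sub_abs_le_abs_sub (y i) (x i)
          linarith [hy i]
      _ = ∑ i, |x i| + d * n := by rw [Finset.sum_add_distrib]; simp
      _ ≤ _ := by linarith
  bdd := by
    intro x hx i
    exact (Finset.single_le_sum (f := fun i => |x i|) (fun i _ => abs_nonneg _)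
      (Finset.mem_univ i)).trans hx
  zero := by simp

theorem bodyT (d : ℕ) (hd : 1 ≤ d) :
    Body d (fun r => {x : Fin d → ℝ | (∀ i, 0 ≤ x i) ∧ (∑ i, x i) ≤ r}) 1 (2 * d) where
  cpos := by omega
  scale := by
    rintro a ha r x ⟨hx0, hx⟩
    refine ⟨fun i => mul_nonneg ha.le (hx0 i), ?_⟩
    simp only [Pi.smul_apply, smul_eq_mul, ← Finset.mul_sum]
    gcongr
  thick := by
    rintro r hr n x y ⟨hx0, hx⟩ hy
    refine ⟨fun i => ?_, ?_⟩
    · have := abs_le.1 (hy i)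
      simp only [Pi.one_apply, Int.cast_one, mul_one]
      linarith [hx0 i]
    · simp only [Pi.one_apply, Int.cast_one, mul_one]
      calc ∑ i, (y i + n) ≤ ∑ i, (x i + 2 * n) := by
            refine Finset.sum_le_sum fun i _ => ?_
            have := abs_le.1 (hy i)
            linarith
        _ = ∑ i, x i + d * (2 * n) := by rw [Finset.sum_add_distrib]; simp
        _ ≤ _ := by push_cast; linarith
  bdd := by
    rintro x ⟨hx0, hx⟩ i
    rw [abs_of_nonneg (hx0 i)]
    exact (Finset.single_le_sum (f := fun i => x i) (fun i _ => hx0 i)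
      (Finset.mem_univ i)).trans hx
  zero := by simp

/-- With `ε_ℝ` the supremum of efficiencies `det(L)/vol(B_{d,1})` over
lattice coverings of `ℝ^d` by the ℓ¹-ball `B_{d,1}`, and `ε_ℤ(k)` the best efficiency
`[ℤ^d : L]/|S_{d,k}|` over lattice coverings of `ℤ^d` by `S_{d,k}`, we have
`ε_ℤ(k) = ε_ℝ + O(1/k)`; and the same with the simplex `T_{d,1}` and `S'_{d,k}`. -/
theorem stmt8 (d : ℕ) (hd : 1 ≤ d) :
    (∃ C : ℝ, ∀ k : ℕ, 1 ≤ k →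
      |sSup {e : ℝ | ∃ L : AddSubgroup (Fin d → ℤ), L.index ≠ 0 ∧
            (∀ x : Fin d → ℤ, ∃ s : Fin d → ℤ, (∑ i, |s i|) ≤ (k : ℤ) ∧ x - s ∈ L) ∧
            e = (L.index : ℝ) /
              (Nat.card {x : Fin d → ℤ // (∑ i, |x i|) ≤ (k : ℤ)} : ℝ)} -
        sSup {e : ℝ | ∃ v : Fin d → (Fin d → ℝ), LinearIndependent ℝ v ∧
            (∀ y : Fin d → ℝ, ∃ b : Fin d → ℝ, (∑ i, |b i|) ≤ (1 : ℝ) ∧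
              y - b ∈ AddSubgroup.closure (Set.range v)) ∧
            e = |(Matrix.of v).det| /
              (volume {x : Fin d → ℝ | (∑ i, |x i|) ≤ (1 : ℝ)}).toReal}| ≤ C / k) ∧
    (∃ C : ℝ, ∀ k : ℕ, 1 ≤ k →
      |sSup {e : ℝ | ∃ L : AddSubgroup (Fin d → ℤ), L.index ≠ 0 ∧
            (∀ x : Fin d → ℤ, ∃ s : Fin d → ℤ, (∀ i, 0 ≤ s i) ∧
              (∑ i, s i) ≤ (k : ℤ) ∧ x - s ∈ L) ∧
            e = (L.index : ℝ) /
              (Nat.card {x : Fin d → ℤ // (∀ i, 0 ≤ x i) ∧ (∑ i, x i) ≤ (k : ℤ)} : ℝ)} -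
        sSup {e : ℝ | ∃ v : Fin d → (Fin d → ℝ), LinearIndependent ℝ v ∧
            (∀ y : Fin d → ℝ, ∃ b : Fin d → ℝ, (∀ i, 0 ≤ b i) ∧ (∑ i, b i) ≤ (1 : ℝ) ∧
              y - b ∈ AddSubgroup.closure (Set.range v)) ∧
            e = |(Matrix.of v).det| /
              (volume {x : Fin d → ℝ | (∀ i, 0 ≤ x i) ∧ (∑ i, x i) ≤ (1 : ℝ)}).toReal}|
        ≤ C / k) := by
  constructor
  · exact (bodyB d hd).main hd (fun k x => (∑ i, |x i|) ≤ (k : ℤ)) (fun k x => by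
      simp only [Set.mem_ofPred_eq]; norm_cast)
  · have h := (bodyT d hd).main hd (fun k x => (∀ i, 0 ≤ x i) ∧ (∑ i, x i) ≤ (k : ℤ))
      (fun k x => by simp only [Set.mem_ofPred_eq]; norm_cast)
    simpa only [Set.mem_ofPred_eq, and_assoc] using h
end

section
/- (Fáry) Let Δ be a nondegenerate triangle (the convex hull of three affinely independent points) in ℝ². Then every lattice L in ℝ² with Δ + L = ℝ² satisfies det(L) ≤ (2/3)·area(Δ), and there exists a lattice L with Δ + L = ℝ² and det(L) = (2/3)·area(Δ). Equivalently, the minimum density of a lattice covering of ℝ² by a triangle is 3/2, i.e., the maximum efficiency is 2/3. -/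
open MeasureTheory
def HC (u1 u2 u3 v1 v2 v3 : ℝ) : Prop :=
  ∀ s1 s2 s3 : ℝ, s1 + s2 + s3 = -1 → ∃ m n : ℤ,
    s1 ≤ m * u1 + n * v1 ∧ s2 ≤ m * u2 + n * v2 ∧ s3 ≤ m * u3 + n * v3

lemma HC.change {u1 u2 u3 v1 v2 v3 : ℝ} (h : HC u1 u2 u3 v1 v2 v3) (p q r s : ℤ)
    (hd : p * s - q * r = 1) :
    HC (p * u1 + q * v1) (p * u2 + q * v2) (p * u3 + q * v3)
      (r * u1 + s * v1) (r * u2 + s * v2) (r * u3 + s * v3) := by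
  intro s1 s2 s3 hs
  obtain ⟨m, n, h1, h2, h3⟩ := h s1 s2 s3 hs
  have hd' : (p : ℝ) * s - q * r = 1 := by exact_mod_cast hd
  refine ⟨m * s - n * r, n * p - m * q, ?_, ?_, ?_⟩
  · push_cast
    refine h1.trans (le_of_eq ?_)
    linear_combination (-(m * u1 + n * v1)) * hd'
  · push_cast
    refine h2.trans (le_of_eq ?_)
    linear_combination (-(m * u2 + n * v2)) * hd'
  · push_cast
    refine h3.trans (le_of_eq ?_)
    linear_combination (-(m * u3 + n * v3)) * hd'

lemma HC.negv {u1 u2 u3 v1 v2 v3 : ℝ} (h : HC u1 u2 u3 v1 v2 v3) :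
    HC u1 u2 u3 (-v1) (-v2) (-v3) := by
  intro s1 s2 s3 hs
  obtain ⟨m, n, h1, h2, h3⟩ := h s1 s2 s3 hs
  exact ⟨m, -n, by push_cast; linarith, by push_cast; linarith, by push_cast; linarith⟩

lemma HC.swap {u1 u2 u3 v1 v2 v3 : ℝ} (h : HC u1 u2 u3 v1 v2 v3) :
    HC v1 v2 v3 u1 u2 u3 := by
  intro s1 s2 s3 hs
  obtain ⟨m, n, h1, h2, h3⟩ := h s1 s2 s3 hs
  exact ⟨n, m, by linarith, by linarith, by linarith⟩

lemma HC.negu {u1 u2 u3 v1 v2 v3 : ℝ} (h : HC u1 u2 u3 v1 v2 v3) :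
    HC (-u1) (-u2) (-u3) v1 v2 v3 := h.swap.negv.swap

lemma HC.p12 {u1 u2 u3 v1 v2 v3 : ℝ} (h : HC u1 u2 u3 v1 v2 v3) :
    HC u2 u1 u3 v2 v1 v3 := by
  intro s1 s2 s3 hs
  obtain ⟨m, n, h1, h2, h3⟩ := h s2 s1 s3 (by linarith)
  exact ⟨m, n, h2, h1, h3⟩

lemma HC.p23 {u1 u2 u3 v1 v2 v3 : ℝ} (h : HC u1 u2 u3 v1 v2 v3) :
    HC u1 u3 u2 v1 v3 v2 := by
  intro s1 s2 s3 hs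
  obtain ⟨m, n, h1, h2, h3⟩ := h s1 s3 s2 (by linarith)
  exact ⟨m, n, h1, h3, h2⟩

/-- outer corner bound -/
lemma corner {a b α β : ℝ} (h0 : 0 ≤ α) (h1 : 0 ≤ β) (h2 : α ≤ a) (h3 : β ≤ a)
    (h4 : α ≤ b) (h5 : β ≤ b)
    (h : HC a (-β) (β - a) (-α) b (α - b)) : a - α + b ≤ 1 := by
  by_contra hc
  push Not at hc
  obtain ⟨m', n', k1, k2, k3⟩ := h (-(a - α) + (a - α + b - 1) / 3) (-b + (a - α + b - 1) / 3)
    ((a - α + b - 1) / 3 - 0 + ((a - α + b) - 1 - (a - α + b - 1))) (by ring)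
  obtain ⟨m, rfl⟩ : ∃ m, m' = -m := ⟨-m', by simp⟩
  obtain ⟨n, rfl⟩ : ∃ n, n' = -n := ⟨-n', by simp⟩
  push_cast at k1 k2 k3
  have e1 : m * a - n * α < a - α := by linarith
  have e2 : n * b - m * β < b := by linarith
  have hm : m ≤ 0 := by
    by_contra hm
    have hm1 : (1 : ℝ) ≤ m := by exact_mod_cast (by omega : 1 ≤ m)
    have hn : 1 ≤ n := by
      by_contra hn
      have : (n : ℝ) ≤ 0 := by exact_mod_cast (by omega : n ≤ 0)
      nlinarith
    have hn1 : (1 : ℝ) ≤ n := by exact_mod_cast hn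
    have f1 : (m : ℝ) < n := by
      by_contra hh
      nlinarith
    have f2 : ((n : ℝ) - 1) < m := by
      by_contra hh
      nlinarith
    have f1' : m < n := by exact_mod_cast f1
    have f2' : n - 1 < m := by exact_mod_cast f2
    omega
  have hm0 : (m : ℝ) ≤ 0 := by exact_mod_cast hm
  have hn : n ≤ 0 := by
    by_contra hn
    have hn1 : (1 : ℝ) ≤ n := by exact_mod_cast (by omega : 1 ≤ n)
    nlinarith
  have hn0 : (n : ℝ) ≤ 0 := by exact_mod_cast hn
  nlinarith

lemma pattern {a b α β : ℝ} (h0 : 0 ≤ α) (h1 : 0 ≤ β) (h2 : α ≤ a) (h3 : β ≤ a)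
    (h4 : α ≤ b) (h5 : β ≤ b)
    (h : HC a (-β) (β - a) (-α) b (α - b)) : a * b - α * β ≤ 1 / 3 := by
  have c1 := corner h0 h1 h2 h3 h4 h5 h
  have c2 := corner h1 h0 h5 h4 h3 h2 h.swap.p12
  nlinarith [sq_nonneg (a - α - (b - β)), sq_nonneg ((a - α) + (b - β) - 2 / 3),
    mul_nonneg (sub_nonneg.2 h2) (sub_nonneg.2 c1), mul_nonneg (sub_nonneg.2 h5) (sub_nonneg.2 c2)]

lemma pattern' {u1 u2 u3 v1 v2 v3 : ℝ} (hu : u1 + u2 + u3 = 0) (hv : v1 + v2 + v3 = 0)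
    (h0 : v1 ≤ 0) (h1 : u2 ≤ 0) (h2 : 0 ≤ u1 + v1) (h3 : u3 ≤ 0) (h4 : v3 ≤ 0)
    (h5 : 0 ≤ u2 + v2) (h : HC u1 u2 u3 v1 v2 v3) : |u1 * v2 - u2 * v1| ≤ 1 / 3 := by
  have := pattern (a := u1) (b := v2) (α := -v1) (β := -u2) (by linarith) (by linarith)
    (by linarith) (by linarith) (by linarith) (by linarith)
    (by convert h using 1 <;> linarith)
  rw [abs_of_nonneg (by nlinarith)]
  linarith

/-- `u` parallel to a side -/
lemma para {a v1 v2 v3 : ℝ} (ha : 0 < a) (hv : v1 + v2 + v3 = 0) (h2 : a ≤ v2)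
    (h : HC a 0 (-a) v1 v2 v3) : |a * v2| ≤ 1 / 3 := by
  have g1 := Int.lt_floor_add_one (-v1 / a)
  have g2 := Int.floor_le (-v1 / a)
  set k := ⌊-v1 / a⌋
  rw [div_lt_iff₀ ha] at g1
  rw [le_div_iff₀ ha] at g2
  have := h.change 1 0 k 1 (by ring)
  have := pattern' (by push_cast; ring) (by push_cast; linarith) (by push_cast; linarith)
    (by push_cast; linarith) (by push_cast; linarith)
    (by push_cast; linarith) (by push_cast; linarith) (by push_cast; linarith) this
  push_cast at this
  convert this using 2
  ring

lemma para' {u1 u2 u3 v1 v2 v3 : ℝ} (hu : u1 + u2 + u3 = 0) (ha : 0 < u1)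
    (h0 : u2 = 0) (hv : v1 + v2 + v3 = 0) (h2 : u1 ≤ |v2|)
    (h : HC u1 u2 u3 v1 v2 v3) : |u1 * v2 - u2 * v1| ≤ 1 / 3 := by
  subst h0
  obtain rfl : u3 = -u1 := by linarith
  rcases abs_cases v2 with ⟨e, _⟩ | ⟨e, _⟩
  · have := para ha hv (by linarith) h
    simpa using this
  · have := para ha (by linarith) (by linarith) h.negv
    simpa using this

def N3 (a b c : ℝ) : ℝ := |a| + |b| + |c|

lemma caseB {u1 u2 u3 v1 v2 v3 : ℝ} (hu : u1 + u2 + u3 = 0) (hv : v1 + v2 + v3 = 0)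
    (p1 : 0 < u1) (p2 : u2 ≤ 0) (p3 : u3 ≤ 0) (q1 : v1 ≤ 0) (q2 : 0 ≤ v2) (q3 : v3 ≤ 0)
    (huv : N3 u1 u2 u3 ≤ N3 v1 v2 v3)
    (hadd : N3 v1 v2 v3 ≤ N3 (u1 + v1) (u2 + v2) (u3 + v3))
    (h : HC u1 u2 u3 v1 v2 v3) : |u1 * v2 - u2 * v1| ≤ 1 / 3 := by
  have e1 : N3 u1 u2 u3 = 2 * u1 := by
    rw [N3, abs_of_pos p1, abs_of_nonpos p2, abs_of_nonpos p3]; linarith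
  have e2 : N3 v1 v2 v3 = 2 * v2 := by
    rw [N3, abs_of_nonpos q1, abs_of_nonneg q2, abs_of_nonpos q3]; linarith
  rw [e1, e2] at huv
  rw [e2] at hadd
  by_cases hz : 0 ≤ u1 + v1
  · exact pattern' hu hv q1 p2 hz p3 q3 (by linarith) h
  · have : u2 = 0 := by
      rw [N3, abs_of_nonpos (by linarith : u1 + v1 ≤ 0),
        abs_of_nonneg (by linarith : 0 ≤ u2 + v2), abs_of_nonpos (by linarith : u3 + v3 ≤ 0)] at hadd
      linarith
    exact para' hu p1 this hv (by rw [abs_of_nonneg q2]; linarith) h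

lemma caseA {u1 u2 u3 v1 v2 v3 : ℝ} (hu : u1 + u2 + u3 = 0) (hv : v1 + v2 + v3 = 0)
    (p1 : 0 < u1) (p2 : u2 ≤ 0) (p3 : u3 ≤ 0) (q1 : 0 ≤ v1) (q2 : v2 ≤ 0) (q3 : v3 ≤ 0)
    (huv : N3 u1 u2 u3 ≤ N3 v1 v2 v3)
    (hsub : N3 v1 v2 v3 ≤ N3 (u1 - v1) (u2 - v2) (u3 - v3))
    (h : HC u1 u2 u3 v1 v2 v3) : |u1 * v2 - u2 * v1| ≤ 1 / 3 := by
  have e1 : N3 u1 u2 u3 = 2 * u1 := by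
    rw [N3, abs_of_pos p1, abs_of_nonpos p2, abs_of_nonpos p3]; linarith
  have e2 : N3 v1 v2 v3 = 2 * v1 := by
    rw [N3, abs_of_nonneg q1, abs_of_nonpos q2, abs_of_nonpos q3]; linarith
  rw [e1, e2] at huv
  rw [e2] at hsub
  have key : (u2 = 0 ∧ v3 = 0) ∨ (u3 = 0 ∧ v2 = 0) := by
    rw [N3, abs_of_nonpos (by linarith : u1 - v1 ≤ 0)] at hsub
    rcases abs_cases (u2 - v2) with ⟨e, _⟩ | ⟨e, _⟩ <;>
    rcases abs_cases (u3 - v3) with ⟨e', _⟩ | ⟨e', _⟩ <;> rw [e, e'] at hsub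
    · linarith
    · left; constructor <;> linarith
    · right; constructor <;> linarith
    · linarith
  rcases key with ⟨k1, k2⟩ | ⟨k1, k2⟩
  · exact para' hu p1 k1 hv (by rw [abs_of_nonpos q2]; linarith) h
  · have := para' (by linarith) p1 k1 (by linarith) (by rw [abs_of_nonpos q3]; linarith) h.p23
    have e : u1 * v2 - u2 * v1 = -(u1 * v3 - u3 * v1) := by
      rw [show v3 = -v1 - v2 by linarith, show u3 = -u1 - u2 by linarith]; ring
    rwa [e, abs_neg]

lemma N3neg (a b c : ℝ) : N3 (-a) (-b) (-c) = N3 a b c := by simp [N3]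

lemma mainA1 {u1 u2 u3 v1 v2 v3 : ℝ} (hu : u1 + u2 + u3 = 0) (hv : v1 + v2 + v3 = 0)
    (p1 : 0 < u1) (p2 : u2 ≤ 0) (p3 : u3 ≤ 0)
    (huv : N3 u1 u2 u3 ≤ N3 v1 v2 v3)
    (hadd : N3 v1 v2 v3 ≤ N3 (u1 + v1) (u2 + v2) (u3 + v3))
    (hsub : N3 v1 v2 v3 ≤ N3 (u1 - v1) (u2 - v2) (u3 - v3))
    (hs : (0 ≤ v1 ∧ v2 ≤ 0 ∧ v3 ≤ 0) ∨ (v1 ≤ 0 ∧ 0 ≤ v2 ∧ v3 ≤ 0) ∨ (v1 ≤ 0 ∧ v2 ≤ 0 ∧ 0 ≤ v3))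
    (h : HC u1 u2 u3 v1 v2 v3) : |u1 * v2 - u2 * v1| ≤ 1 / 3 := by
  rcases hs with ⟨q1, q2, q3⟩ | ⟨q1, q2, q3⟩ | ⟨q1, q2, q3⟩
  · exact caseA hu hv p1 p2 p3 q1 q2 q3 huv hsub h
  · exact caseB hu hv p1 p2 p3 q1 q2 q3 huv hadd h
  · have := caseB (by linarith) (by linarith) p1 p3 p2 q1 q3 q2 (by unfold N3 at *; linarith)
      (by unfold N3 at *; linarith) h.p23
    have e : u1 * v2 - u2 * v1 = -(u1 * v3 - u3 * v1) := by
      rw [show v3 = -v1 - v2 by linarith, show u3 = -u1 - u2 by linarith]; ring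
    rwa [e, abs_neg]

lemma sectors {v1 v2 v3 : ℝ} (hv : v1 + v2 + v3 = 0) :
    ((0 ≤ v1 ∧ v2 ≤ 0 ∧ v3 ≤ 0) ∨ (v1 ≤ 0 ∧ 0 ≤ v2 ∧ v3 ≤ 0) ∨ (v1 ≤ 0 ∧ v2 ≤ 0 ∧ 0 ≤ v3)) ∨
    ((0 ≤ -v1 ∧ -v2 ≤ 0 ∧ -v3 ≤ 0) ∨ (-v1 ≤ 0 ∧ 0 ≤ -v2 ∧ -v3 ≤ 0) ∨
      (-v1 ≤ 0 ∧ -v2 ≤ 0 ∧ 0 ≤ -v3)) := by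
  simp only [neg_nonneg, neg_nonpos]
  rcases le_total 0 v1 with a | a <;> rcases le_total 0 v2 with b | b <;>
    rcases le_total 0 v3 with c | c <;> simp only [a, b, c, true_and, and_true, true_or, or_true]
  · right; left; linarith
  · left; left; linarith

lemma mainA {u1 u2 u3 v1 v2 v3 : ℝ} (hu : u1 + u2 + u3 = 0) (hv : v1 + v2 + v3 = 0)
    (p1 : 0 < u1) (p2 : u2 ≤ 0) (p3 : u3 ≤ 0)
    (huv : N3 u1 u2 u3 ≤ N3 v1 v2 v3)
    (hadd : N3 v1 v2 v3 ≤ N3 (u1 + v1) (u2 + v2) (u3 + v3))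
    (hsub : N3 v1 v2 v3 ≤ N3 (u1 - v1) (u2 - v2) (u3 - v3))
    (h : HC u1 u2 u3 v1 v2 v3) : |u1 * v2 - u2 * v1| ≤ 1 / 3 := by
  rcases sectors hv with hs | hs
  · exact mainA1 hu hv p1 p2 p3 huv hadd hsub hs h
  · have := mainA1 hu (by linarith) p1 p2 p3 (by rwa [N3neg])
      (by rw [N3neg]; simpa only [← sub_eq_add_neg] using hsub)
      (by rw [N3neg]; simpa only [sub_neg_eq_add] using hadd) hs h.negv
    rw [← abs_neg]
    convert this using 2
    ring

lemma main1 {u1 u2 u3 v1 v2 v3 : ℝ} (hu : u1 + u2 + u3 = 0) (hv : v1 + v2 + v3 = 0)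
    (huv : N3 u1 u2 u3 ≤ N3 v1 v2 v3)
    (hadd : N3 v1 v2 v3 ≤ N3 (u1 + v1) (u2 + v2) (u3 + v3))
    (hsub : N3 v1 v2 v3 ≤ N3 (u1 - v1) (u2 - v2) (u3 - v3))
    (hs : (0 ≤ u1 ∧ u2 ≤ 0 ∧ u3 ≤ 0) ∨ (u1 ≤ 0 ∧ 0 ≤ u2 ∧ u3 ≤ 0) ∨ (u1 ≤ 0 ∧ u2 ≤ 0 ∧ 0 ≤ u3))
    (h : HC u1 u2 u3 v1 v2 v3) : |u1 * v2 - u2 * v1| ≤ 1 / 3 := by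
  by_cases hz : u1 = 0 ∧ u2 = 0
  · rw [hz.1, hz.2]; norm_num
  rcases hs with ⟨q1, q2, q3⟩ | ⟨q1, q2, q3⟩ | ⟨q1, q2, q3⟩
  · have : 0 < u1 := by
      refine lt_of_le_of_ne q1 fun e => hz ⟨e.symm, by linarith⟩
    exact mainA hu hv this q2 q3 huv hadd hsub h
  · have : 0 < u2 := by
      refine lt_of_le_of_ne q2 fun e => hz ⟨by linarith, e.symm⟩
    have := mainA (by linarith) (by linarith) this q1 q3 (by unfold N3 at *; linarith)
      (by unfold N3 at *; linarith) (by unfold N3 at *; linarith) h.p12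
    rw [← abs_neg]
    convert this using 2
    ring
  · have : 0 < u3 := by
      refine lt_of_le_of_ne q3 fun e => hz ⟨by linarith, by linarith⟩
    have := mainA (by linarith) (by linarith) this q1 q2 (by unfold N3 at *; linarith)
      (by unfold N3 at *; linarith) (by unfold N3 at *; linarith) h.p23.p12
    have e : u1 * v2 - u2 * v1 = (u3 * v1 - u1 * v3) := by
      rw [show v3 = -v1 - v2 by linarith, show u3 = -u1 - u2 by linarith]; ring
    rwa [e]

lemma main2 {u1 u2 u3 v1 v2 v3 : ℝ} (hu : u1 + u2 + u3 = 0) (hv : v1 + v2 + v3 = 0)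
    (huv : N3 u1 u2 u3 ≤ N3 v1 v2 v3)
    (hadd : N3 v1 v2 v3 ≤ N3 (u1 + v1) (u2 + v2) (u3 + v3))
    (hsub : N3 v1 v2 v3 ≤ N3 (u1 - v1) (u2 - v2) (u3 - v3))
    (h : HC u1 u2 u3 v1 v2 v3) : |u1 * v2 - u2 * v1| ≤ 1 / 3 := by
  rcases sectors hu with hs | hs
  · exact main1 hu hv huv hadd hsub hs h
  · have := main1 (by linarith) hv (by rwa [N3neg])
      (by rw [← N3neg (-u1 + v1)]; convert hsub using 2 <;> ring)
      (by rw [← N3neg (-u1 - v1)]; convert hadd using 2 <;> ring) hs h.negu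
    rw [← abs_neg]
    convert this using 2
    ring

lemma coef_bound {x1 y1 x2 y2 m n B : ℝ} (hD : x1 * y2 - y1 * x2 ≠ 0)
    (h : N3 (m * x1 + n * x2) (m * y1 + n * y2) (m * (-x1 - y1) + n * (-x2 - y2)) ≤ B) :
    |m| ≤ B * (|x1| + |y1| + |x2| + |y2|) / |x1 * y2 - y1 * x2| ∧
    |n| ≤ B * (|x1| + |y1| + |x2| + |y2|) / |x1 * y2 - y1 * x2| := by
  have hp := abs_pos.2 hD
  have b1 : |m * x1 + n * x2| ≤ B := by
    unfold N3 at h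
    linarith [abs_nonneg (m * y1 + n * y2), abs_nonneg (m * (-x1 - y1) + n * (-x2 - y2))]
  have b2 : |m * y1 + n * y2| ≤ B := by
    unfold N3 at h
    linarith [abs_nonneg (m * x1 + n * x2), abs_nonneg (m * (-x1 - y1) + n * (-x2 - y2))]
  have hB : 0 ≤ B := (abs_nonneg _).trans b1
  constructor
  · rw [le_div_iff₀ hp, ← abs_mul,
      show m * (x1 * y2 - y1 * x2) = (m * x1 + n * x2) * y2 - (m * y1 + n * y2) * x2 by ring]
    refine (abs_sub _ _).trans ?_
    rw [abs_mul, abs_mul]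
    nlinarith [abs_nonneg x1, abs_nonneg x2, abs_nonneg y1, abs_nonneg y2]
  · rw [le_div_iff₀ hp, ← abs_mul,
      show n * (x1 * y2 - y1 * x2) = (m * y1 + n * y2) * x1 - (m * x1 + n * x2) * y1 by ring]
    refine (abs_sub _ _).trans ?_
    rw [abs_mul, abs_mul]
    nlinarith [abs_nonneg x1, abs_nonneg x2, abs_nonneg y1, abs_nonneg y2]

lemma bound_main {x1 y1 x2 y2 : ℝ} (h : HC x1 y1 (-x1 - y1) x2 y2 (-x2 - y2)) :
    |x1 * y2 - y1 * x2| ≤ 1 / 3 := by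
  by_cases hD : x1 * y2 - y1 * x2 = 0
  · rw [hD]; norm_num
  let g : ℤ → ℤ → ℝ := fun m n =>
    N3 (m * x1 + n * x2) (m * y1 + n * y2) (m * (-x1 - y1) + n * (-x2 - y2))
  have g0 : ∀ m n, 0 ≤ g m n := fun m n => by simp only [g, N3]; positivity
  let Φ : (ℤ × ℤ) × (ℤ × ℤ) → ℝ := fun z => g z.1.1 z.1.2 + g z.2.1 z.2.2
  let B := Φ ((1, 0), (0, 1))
  let S : Set ((ℤ × ℤ) × (ℤ × ℤ)) := {z | z.1.1 * z.2.2 - z.1.2 * z.2.1 = 1 ∧ Φ z ≤ B}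
  let K : ℤ := ⌈B * (|x1| + |y1| + |x2| + |y2|) / |x1 * y2 - y1 * x2|⌉
  have hgK : ∀ m n, g m n ≤ B → (-K ≤ m ∧ m ≤ K) ∧ (-K ≤ n ∧ n ≤ K) := by
    intro m n hmn
    obtain ⟨c1, c2⟩ := coef_bound hD hmn
    have c1' := c1.trans (Int.le_ceil _)
    have c2' := c2.trans (Int.le_ceil _)
    exact ⟨abs_le.1 (by exact_mod_cast c1'), abs_le.1 (by exact_mod_cast c2')⟩
  have hfin : S.Finite := by
    refine (Set.finite_Icc (((-K, -K), (-K, -K)) : (ℤ × ℤ) × (ℤ × ℤ)) ((K, K), (K, K))).subset ?_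
    rintro ⟨⟨p, q⟩, ⟨r, s⟩⟩ ⟨-, hz⟩
    have hz' : g p q + g r s ≤ B := hz
    have k1 := hgK p q (by linarith [g0 r s])
    have k2 := hgK r s (by linarith [g0 p q])
    exact ⟨⟨⟨k1.1.1, k1.2.1⟩, ⟨k2.1.1, k2.2.1⟩⟩, ⟨⟨k1.1.2, k1.2.2⟩, ⟨k2.1.2, k2.2.2⟩⟩⟩
  obtain ⟨⟨⟨p, q⟩, ⟨r, s⟩⟩, ⟨hz1, hz2⟩, hmin⟩ := Set.exists_min_image S Φ hfin
    ⟨((1, 0), (0, 1)), by simp, le_refl _⟩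
  have hmin' : ∀ p' q' r' s' : ℤ, p' * s' - q' * r' = 1 → g p q + g r s ≤ g p' q' + g r' s' := by
    intro p' q' r' s' hd
    by_cases hb : Φ ((p', q'), (r', s')) ≤ B
    · exact hmin ((p', q'), (r', s')) ⟨hd, hb⟩
    · exact hz2.trans (not_le.1 hb).le
  replace hz1 : p * s - q * r = 1 := hz1
  have hz1' : (p : ℝ) * s - q * r = 1 := by exact_mod_cast hz1
  have m1 := hmin' p q (r + p) (s + q) (by linarith)
  have m2 := hmin' p q (r - p) (s - q) (by linarith)
  have m3 := hmin' (p + r) (q + s) r s (by linarith)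
  have m4 := hmin' (p - r) (q - s) r s (by linarith)
  have hc := h.change p q r s hz1
  have hdet : (p * x1 + q * x2) * (r * y1 + s * y2) - (p * y1 + q * y2) * (r * x1 + s * x2)
      = x1 * y2 - y1 * x2 := by
    linear_combination (x1 * y2 - y1 * x2) * hz1'
  simp only [g] at m1 m2 m3 m4
  push_cast at m1 m2 m3 m4
  rcases le_total (g p q) (g r s) with hl | hl
  · rw [← hdet]
    refine main2 (by ring) (by ring) hl ?_ ?_ hc
    · refine (le_of_add_le_add_left m1).trans (le_of_eq ?_)
      congr 1 <;> ring
    · refine (le_of_add_le_add_left m2).trans (le_of_eq ?_)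
      rw [← N3neg]
      congr 1 <;> ring
  · rw [← hdet, abs_sub_comm, mul_comm (_ + _), mul_comm (_ + _) (_ * y1 + _)]
    have := main2 (by ring) (by ring) hl ?_ ?_ hc.swap
    · convert this using 2
      ring
    · refine (le_of_add_le_add_right m3).trans (le_of_eq ?_)
      congr 1 <;> ring
    · refine (le_of_add_le_add_right m4).trans (le_of_eq ?_)
      rw [← N3neg]
      congr 1 <;> ring

def stdTri : Set (Fin 2 → ℝ) := {z | 0 ≤ z 0 ∧ 0 ≤ z 1 ∧ z 0 + z 1 ≤ 1}

lemma hull_iff (p : Fin 3 → (Fin 2 → ℝ)) (t : Fin 2 → ℝ) :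
    t ∈ convexHull ℝ (Set.range p) ↔ ∃ x y : ℝ, 0 ≤ x ∧ 0 ≤ y ∧ x + y ≤ 1 ∧
      t = p 0 + (x • (p 1 - p 0) + y • (p 2 - p 0)) := by
  constructor
  · intro ht
    have hc : Convex ℝ {t : Fin 2 → ℝ | ∃ x y : ℝ, 0 ≤ x ∧ 0 ≤ y ∧ x + y ≤ 1 ∧
      t = p 0 + (x • (p 1 - p 0) + y • (p 2 - p 0))} := by
      rintro _ ⟨x, y, h1, h2, h3, rfl⟩ _ ⟨x', y', h1', h2', h3', rfl⟩ a b ha hb hab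
      refine ⟨a * x + b * x', a * y + b * y', by positivity, by positivity, by nlinarith, ?_⟩
      ext i
      simp only [Pi.add_apply, Pi.smul_apply, Pi.sub_apply, smul_eq_mul]
      linear_combination (p 0 i) * hab
    refine convexHull_min ?_ hc ht
    rintro _ ⟨i, rfl⟩
    fin_cases i
    · exact ⟨0, 0, by norm_num, by norm_num, by norm_num, by simp⟩
    · exact ⟨1, 0, by norm_num, by norm_num, by norm_num, by simp⟩
    · exact ⟨0, 1, by norm_num, by norm_num, by norm_num, by simp⟩
  · rintro ⟨x, y, h1, h2, h3, rfl⟩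
    have := (convex_convexHull ℝ (Set.range p)).sum_mem (t := Finset.univ) (w := ![1 - x - y, x, y])
      (z := p) (by intro i _; fin_cases i <;> simp <;> linarith) (by simp [Fin.sum_univ_three]; ring)
      (fun i _ => subset_convexHull ℝ _ ⟨i, rfl⟩)
    convert this using 1
    ext i
    simp [Fin.sum_univ_three]
    ring

lemma vol_std : (volume stdTri).toReal = 1 / 2 := by
  have hm : MeasurableSet {z : ℝ × ℝ | 0 ≤ z.1 ∧ 0 ≤ z.2 ∧ z.1 + z.2 ≤ 1} := by
    have a1 : MeasurableSet {z : ℝ × ℝ | 0 ≤ z.1} := measurableSet_le (by fun_prop) (by fun_prop)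
    have a2 : MeasurableSet {z : ℝ × ℝ | 0 ≤ z.2} := measurableSet_le (by fun_prop) (by fun_prop)
    have a3 : MeasurableSet {z : ℝ × ℝ | z.1 + z.2 ≤ 1} :=
      measurableSet_le (by fun_prop) (by fun_prop)
    exact a1.inter (a2.inter a3)
  have e : stdTri = MeasurableEquiv.finTwoArrow ⁻¹'
      {z : ℝ × ℝ | 0 ≤ z.1 ∧ 0 ≤ z.2 ∧ z.1 + z.2 ≤ 1} := by
    ext z; rfl
  rw [e, (volume_preserving_finTwoArrow ℝ).measure_preimage hm.nullMeasurableSet,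
    Measure.volume_eq_prod, Measure.prod_apply hm]
  have : ∀ x : ℝ, volume (Prod.mk x ⁻¹' {z : ℝ × ℝ | 0 ≤ z.1 ∧ 0 ≤ z.2 ∧ z.1 + z.2 ≤ 1}) =
      (Set.Icc (0:ℝ) 1).indicator (fun x => ENNReal.ofReal (1 - x)) x := by
    intro x
    by_cases hx : x ∈ Set.Icc (0:ℝ) 1
    · rw [Set.indicator_of_mem hx]
      have : Prod.mk x ⁻¹' {z : ℝ × ℝ | 0 ≤ z.1 ∧ 0 ≤ z.2 ∧ z.1 + z.2 ≤ 1} = Set.Icc 0 (1 - x) := by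
        ext y
        simp only [Set.mem_preimage, Set.mem_ofPred_eq, Set.mem_Icc]
        constructor
        · rintro ⟨_, a, b⟩; exact ⟨a, by linarith⟩
        · rintro ⟨a, b⟩; exact ⟨hx.1, a, by linarith⟩
      rw [this, Real.volume_Icc, sub_zero]
    · rw [Set.indicator_of_notMem hx]
      have : Prod.mk x ⁻¹' {z : ℝ × ℝ | 0 ≤ z.1 ∧ 0 ≤ z.2 ∧ z.1 + z.2 ≤ 1} = ∅ := by
        ext y
        simp only [Set.mem_preimage, Set.mem_ofPred_eq, Set.mem_empty_iff_false, iff_false]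
        rintro ⟨a, b, c⟩
        exact hx ⟨a, by linarith⟩
      rw [this, measure_empty]
  simp_rw [this]
  rw [lintegral_indicator measurableSet_Icc, ← ofReal_integral_eq_lintegral_ofReal]
  · rw [integral_Icc_eq_integral_Ioc, ← intervalIntegral.integral_of_le zero_le_one]
    have : (∫ x in (0:ℝ)..1, (1 - x)) = 1 / 2 := by
      rw [intervalIntegral.integral_sub (by simp) (by simp)]
      norm_num
    rw [this, ENNReal.toReal_ofReal (by norm_num)]
  · exact (by fun_prop : Continuous fun x : ℝ => 1 - x).continuousOn.integrableOn_Icc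
  · filter_upwards [ae_restrict_mem measurableSet_Icc] with x hx
    simpa using hx.2

lemma vol_tri (p : Fin 3 → (Fin 2 → ℝ)) :
    (volume (convexHull ℝ (Set.range p))).toReal =
      |(Matrix.of ![p 1 - p 0, p 2 - p 0]).det| / 2 := by
  have e : convexHull ℝ (Set.range p) = (fun w => p 0 + w) ''
      (Matrix.toLin' (Matrix.of ![p 1 - p 0, p 2 - p 0]).transpose '' stdTri) := by
    ext t
    rw [hull_iff, Set.image_image]
    have key : ∀ z : Fin 2 → ℝ,
        Matrix.toLin' (Matrix.of ![p 1 - p 0, p 2 - p 0]).transpose z =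
          z 0 • (p 1 - p 0) + z 1 • (p 2 - p 0) := by
      intro z
      ext i
      simp [Matrix.mulVec, dotProduct, Fin.sum_univ_two]
      ring
    constructor
    · rintro ⟨x, y, h1, h2, h3, rfl⟩
      exact ⟨![x, y], ⟨by simpa, by simpa, by simpa⟩, by simp only [key]; simp⟩
    · rintro ⟨z, ⟨h1, h2, h3⟩, rfl⟩
      exact ⟨z 0, z 1, h1, h2, h3, by simp only [key]⟩
  rw [e, Set.image_add_left, measure_preimage_add, Measure.addHaar_image_linearMap,
    LinearMap.det_toLin', Matrix.det_transpose, ENNReal.toReal_mul, vol_std,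
    ENNReal.toReal_ofReal (abs_nonneg _)]
  ring

lemma mem_cl_s11 (v : Fin 2 → (Fin 2 → ℝ)) (l : Fin 2 → ℝ) :
    l ∈ AddSubgroup.closure (Set.range v) ↔ ∃ m n : ℤ, (m : ℝ) • v 0 + (n : ℝ) • v 1 = l := by
  have : Set.range v = {v 0, v 1} := by
    ext x
    simp [Fin.exists_fin_two, eq_comm]
  rw [this, AddSubgroup.mem_closure_pair]
  simp only [Int.cast_smul_eq_zsmul]

lemma det_ne (p : Fin 3 → (Fin 2 → ℝ)) (hp : AffineIndependent ℝ p) :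
    (Matrix.of ![p 1 - p 0, p 2 - p 0]).det ≠ 0 := by
  intro h0
  rw [affineIndependent_iff] at hp
  obtain ⟨c, hc, hc0⟩ := Matrix.exists_vecMul_eq_zero_iff.2 h0
  have h := hp Finset.univ ![-c 0 - c 1, c 0, c 1] (by simp [Fin.sum_univ_three]; ring) (by
    ext i
    have := congrFun hc0 i
    simp [Matrix.vecMul, dotProduct, Fin.sum_univ_two] at this
    simp [Fin.sum_univ_three]
    linarith)
  apply hc
  ext i
  fin_cases i
  · simpa using h 1 (Finset.mem_univ _)
  · simpa using h 2 (Finset.mem_univ _)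

lemma cover_std (X Y : ℝ) : ∃ m n : ℤ, 0 ≤ X - (2 * m - n) / 3 ∧ 0 ≤ Y - (2 * n - m) / 3 ∧
    X - (2 * m - n) / 3 + (Y - (2 * n - m) / 3) ≤ 1 := by
  have a1 := Int.lt_floor_add_one (3 * X)
  have a2 := Int.floor_le (3 * X)
  have b1 := Int.lt_floor_add_one (3 * Y)
  have b2 := Int.floor_le (3 * Y)
  set i := ⌊3 * X⌋
  set j := ⌊3 * Y⌋
  obtain ⟨k, hk⟩ : ∃ k, i - j = 3 * k ∨ i - j = 3 * k + 1 ∨ i - j = 3 * k + 2 :=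
    ⟨(i - j) / 3, by omega⟩
  rcases hk with hk | hk | hk
  · have hk' : (i : ℝ) - j = 3 * k := by exact_mod_cast hk
    refine ⟨j + 2 * k, j + k, ?_, ?_, ?_⟩ <;> push_cast <;> linarith
  · have hk' : (i : ℝ) - j = 3 * k + 1 := by exact_mod_cast hk
    refine ⟨j + 2 * k, j + k, ?_, ?_, ?_⟩ <;> push_cast <;> linarith
  · have hk' : (i : ℝ) - j = 3 * k + 2 := by exact_mod_cast hk
    refine ⟨j - 1 + 2 * (k + 1), j - 1 + (k + 1), ?_, ?_, ?_⟩ <;> push_cast <;> linarith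

lemma coords_s11 (e f : Fin 2 → ℝ) (h : (Matrix.of ![e, f]).det ≠ 0) (w : Fin 2 → ℝ) :
    ∃ x y : ℝ, w = x • e + y • f := by
  rw [Matrix.det_fin_two] at h
  simp at h
  refine ⟨(w 0 * f 1 - w 1 * f 0) / (e 0 * f 1 - e 1 * f 0),
    (e 0 * w 1 - e 1 * w 0) / (e 0 * f 1 - e 1 * f 0), ?_⟩
  ext i
  have hd : (e 0 * f 1 - e 1 * f 0) * (e 0 * f 1 - e 1 * f 0)⁻¹ = 1 := mul_inv_cancel₀ h
  simp only [div_eq_mul_inv, Pi.add_apply, Pi.smul_apply, smul_eq_mul]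
  fin_cases i
  · simp only [Fin.zero_eta]
    linear_combination (-w 0) * hd
  · simp only [Fin.mk_one]
    linear_combination (-w 1) * hd

lemma coords_inj (e f : Fin 2 → ℝ) (h : (Matrix.of ![e, f]).det ≠ 0) {x y x' y' : ℝ}
    (hh : x • e + y • f = x' • e + y' • f) : x = x' ∧ y = y' := by
  rw [Matrix.det_fin_two] at h
  simp at h
  have h0 := congrFun hh 0
  have h1 := congrFun hh 1
  simp at h0 h1
  constructor
  · apply mul_right_cancel₀ h
    linear_combination f 1 * h0 - f 0 * h1
  · apply mul_right_cancel₀ h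
    linear_combination e 0 * h1 - e 1 * h0

lemma det_comb (e f : Fin 2 → ℝ) (v : Fin 2 → Fin 2 → ℝ) (x1 y1 x2 y2 : ℝ)
    (h0 : v 0 = x1 • e + y1 • f) (h1 : v 1 = x2 • e + y2 • f) :
    (Matrix.of v).det = (x1 * y2 - y1 * x2) * (Matrix.of ![e, f]).det := by
  rw [Matrix.det_fin_two, Matrix.det_fin_two]
  simp [h0, h1]
  ring

/-- Fáry: For a nondegenerate triangle `Δ` in `ℝ²` (convex hull of
three affinely independent points), every lattice `L` with `Δ + L = ℝ²` satisfies
`det(L) ≤ (2/3)·area(Δ)`, and some lattice attains this bound: the maximum efficiency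
of a lattice covering of the plane by a triangle is `2/3` (minimum density `3/2`). -/
theorem stmt11 (p : Fin 3 → (Fin 2 → ℝ)) (hp : AffineIndependent ℝ p) :
    (∀ v : Fin 2 → (Fin 2 → ℝ), LinearIndependent ℝ v →
      (∀ y : Fin 2 → ℝ, ∃ t ∈ convexHull ℝ (Set.range p),
        y - t ∈ AddSubgroup.closure (Set.range v)) →
      |(Matrix.of v).det| ≤ (2 / 3) * (volume (convexHull ℝ (Set.range p))).toReal) ∧
    (∃ v : Fin 2 → (Fin 2 → ℝ), LinearIndependent ℝ v ∧
      (∀ y : Fin 2 → ℝ, ∃ t ∈ convexHull ℝ (Set.range p),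
        y - t ∈ AddSubgroup.closure (Set.range v)) ∧
      |(Matrix.of v).det| = (2 / 3) * (volume (convexHull ℝ (Set.range p))).toReal) := by
  have hD := det_ne p hp
  rw [vol_tri]
  set D := (Matrix.of ![p 1 - p 0, p 2 - p 0]).det with hDdef
  set e := p 1 - p 0 with he
  set f := p 2 - p 0 with hf
  constructor
  · intro v hv hcov
    obtain ⟨x1, y1, h1⟩ := coords_s11 e f hD (v 0)
    obtain ⟨x2, y2, h2⟩ := coords_s11 e f hD (v 1)
    have hH : HC x1 y1 (-x1 - y1) x2 y2 (-x2 - y2) := by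
      intro s1 s2 s3 hs
      obtain ⟨t, ht, hl⟩ := hcov (p 0 + ((-s1) • e + (-s2) • f))
      obtain ⟨x, y, hx, hy, hxy, rfl⟩ := (hull_iff p t).1 ht
      obtain ⟨m, n, hmn⟩ := (mem_cl_s11 v _).1 hl
      have := coords_inj e f hD (x := m * x1 + n * x2) (y := m * y1 + n * y2)
        (x' := -s1 - x) (y' := -s2 - y) (by
          rw [h1, h2] at hmn
          ext i
          have := congrFun hmn i
          simp only [Pi.add_apply, Pi.sub_apply, Pi.smul_apply, smul_eq_mul, he, hf] at this ⊢
          linarith)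
      refine ⟨-m, -n, ?_, ?_, ?_⟩ <;> push_cast <;> linarith [this.1, this.2]
    rw [det_comb e f v x1 y1 x2 y2 h1 h2, abs_mul]
    have := bound_main hH
    have hDn := abs_nonneg D
    nlinarith
  · let v : Fin 2 → Fin 2 → ℝ := ![(2 / 3 : ℝ) • e + (-1 / 3 : ℝ) • f, (-1 / 3 : ℝ) • e + (2 / 3 : ℝ) • f]
    have hdet : (Matrix.of v).det = (1 / 3) * D := by
      rw [det_comb e f v _ _ _ _ rfl rfl]
      norm_num [hDdef]
    refine ⟨v, ?_, ?_, ?_⟩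
    · have : IsUnit (Matrix.of v) := by
        rw [Matrix.isUnit_iff_isUnit_det, hdet]
        exact (mul_ne_zero (by norm_num) hD).isUnit
      exact Matrix.linearIndependent_rows_of_isUnit this
    · intro z
      obtain ⟨X, Y, hXY⟩ := coords_s11 e f hD (z - p 0)
      obtain ⟨m, n, k1, k2, k3⟩ := cover_std X Y
      refine ⟨_, (hull_iff p _).2 ⟨_, _, k1, k2, k3, rfl⟩, (mem_cl_s11 v _).2 ⟨m, n, ?_⟩⟩
      ext i
      have := congrFun hXY i
      simp [v, he, hf] at this ⊢
      linarith
    · rw [hdet, abs_mul, abs_of_pos (by norm_num : (0 : ℝ) < 1 / 3)]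
      ring
end

section
/- Let v_1 = (1,1,1), v_2 = (1,−1,1), v_3 = (1,1,−1), which generate the body-centered cubic lattice L_bcc (the set of points of ℤ³ whose coordinates are all even or all odd), and note that B_{3,3/2} + L_bcc = ℝ³ with |det(v_1,v_2,v_3)| = 4. Then L_bcc is locally optimal among lattices L with B_{3,3/2} + L = ℝ³: there is a neighborhood U of (v_1,v_2,v_3) in (ℝ³)³ such that for all (v'_1,v'_2,v'_3) ∈ U, if the lattice L generated by v'_1,v'_2,v'_3 satisfies B_{3,3/2} + L = ℝ³, then |det(v'_1,v'_2,v'_3)| ≤ 4, with equality only when (v'_1,v'_2,v'_3) = (v_1,v_2,v_3). -/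
lemma bcc_far (m1 m2 m3 : ℤ) (h12 : (2:ℤ) ∣ m1 - m2) (h13 : (2:ℤ) ∣ m1 - m3)
    (n1 : ¬ (m1 = 0 ∧ m2 = 0 ∧ m3 = 0)) (n2 : ¬ (m1 = 1 ∧ m2 = 1 ∧ m3 = 1))
    (n3 : ¬ (m1 = 2 ∧ m2 = 0 ∧ m3 = 0)) (n4 : ¬ (m1 = 1 ∧ m2 = 1 ∧ m3 = -1)) :
    5 ≤ |2 - 2 * m1| + |1 - 2 * m2| + |2 * m3| := by
  rcases abs_cases (2 - 2 * m1) with h | h <;> rcases abs_cases (1 - 2 * m2) with h' | h' <;>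
  rcases abs_cases (2 * m3) with h'' | h'' <;> omega

lemma exists_eq_point (t1 t2 t3 u1 q1 c : ℝ) :
    ∃ p1 p3 : ℝ, 2 * p1 = |p3 - t3| - |p3| + t1 - t2 ∧ 2 * p3 = |p1 - u1| - |p1 - q1| + c := by
  let g : ℝ → ℝ := fun x => (|x - u1| - |x - q1| + c) / 2
  let h : ℝ → ℝ := fun x => 2 * x - (|g x - t3| - |g x| + t1 - t2)
  have hc : Continuous h := by fun_prop
  have hb : ∀ x, |(|g x - t3| - |g x|)| ≤ |t3| := by
    intro x
    have := abs_abs_sub_abs_le_abs_sub (g x - t3) (g x)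
    have e : g x - t3 - g x = - t3 := by ring
    rwa [e, abs_neg] at this
  have K1 : h (-(|t3| + |t1 - t2|)) ≤ 0 := by
    have := abs_le.1 (hb (-(|t3| + |t1 - t2|)))
    have h2 := neg_abs_le (t1 - t2)
    have h3 := abs_nonneg t3
    have h4 := abs_nonneg (t1 - t2)
    simp only [h]
    linarith [this.1]
  have K2 : 0 ≤ h (|t3| + |t1 - t2|) := by
    have := abs_le.1 (hb (|t3| + |t1 - t2|))
    have h2 := le_abs_self (t1 - t2)
    have h3 := abs_nonneg t3
    have h4 := abs_nonneg (t1 - t2)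
    simp only [h]
    linarith [this.2]
  obtain ⟨x, hx⟩ := mem_range_of_exists_le_of_exists_ge hc ⟨_, K1⟩ ⟨_, K2⟩
  refine ⟨x, g x, ?_, ?_⟩
  · simp only [h] at hx; linarith
  · simp only [g]; ring

/-- covering by the image of the bcc lattice under the identity plus a small matrix -/
def BccCov (a11 a12 a13 a21 a22 a23 a31 a32 a33 : ℝ) : Prop :=
  ∀ y1 y2 y3 : ℝ, ∃ m1 m2 m3 : ℤ, (2:ℤ) ∣ m1 - m2 ∧ (2:ℤ) ∣ m1 - m3 ∧
    |y1 - (m1 + (a11 * m1 + a12 * m2 + a13 * m3))| +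
    |y2 - (m2 + (a21 * m1 + a22 * m2 + a23 * m3))| +
    |y3 - (m3 + (a31 * m1 + a32 * m2 + a33 * m3))| ≤ 3 / 2

lemma abs_tri (y p m s : ℝ) : |y - m| - |p| - |s| ≤ |y + p - (m + s)| := by
  have h1 : y - m = (y + p - (m + s)) + (-p + s) := by ring
  have h2 := abs_add_le (y + p - (m + s)) (-p + s)
  have h3 := abs_add_le (-p) s
  rw [abs_neg] at h3
  rw [h1]; linarith

lemma abs_comb (a b c x y z e : ℝ) (ha : |a| ≤ e) (hb : |b| ≤ e) (hc : |c| ≤ e) :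
    |a * x + b * y + c * z| ≤ e * (|x| + |y| + |z|) := by
  have h1 := abs_add_le (a * x + b * y) (c * z)
  have h2 := abs_add_le (a * x) (b * y)
  rw [abs_mul] at h1 h2
  rw [abs_mul] at h2
  have := mul_le_mul_of_nonneg_right ha (abs_nonneg x)
  have := mul_le_mul_of_nonneg_right hb (abs_nonneg y)
  have := mul_le_mul_of_nonneg_right hc (abs_nonneg z)
  linarith

lemma cov_key (a11 a12 a13 a21 a22 a23 a31 a32 a33 : ℝ)
    (h11 : |a11| ≤ 1/100) (h12 : |a12| ≤ 1/100) (h13 : |a13| ≤ 1/100)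
    (h21 : |a21| ≤ 1/100) (h22 : |a22| ≤ 1/100) (h23 : |a23| ≤ 1/100)
    (h31 : |a31| ≤ 1/100) (h32 : |a32| ≤ 1/100) (h33 : |a33| ≤ 1/100)
    (H : BccCov a11 a12 a13 a21 a22 a23 a31 a32 a33) :
    |a13| + |a31| + (a11 + a22 + a33) ≤ 0 := by
  by_contra hneg
  push Not at hneg
  obtain ⟨p1, p3, e1, e3⟩ := exists_eq_point (2*a11) (2*a21) (2*a31) (a11+a12+a13) (a11+a12-a13)
    (2*a23 + 2*a31 + 2*a32)
  obtain ⟨p2, e2⟩ : ∃ p2 : ℝ, 2 * p2 = |p1 - (a11+a12+a13)| + (a21+a22+a23) + (a31+a32+a33)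
    - p3 - p1 - |p3| := ⟨_, mul_div_cancel₀ _ two_ne_zero⟩
  have s13 : 2 * |a13| ≤ |p1 - (a11+a12+a13)| + |p1 - (a11+a12-a13)| := by
    have := abs_sub (p1 - (a11+a12+a13)) (p1 - (a11+a12-a13))
    rw [show p1 - (a11+a12+a13) - (p1 - (a11+a12-a13)) = -(2 * a13) by ring, abs_neg, abs_mul] at this
    simpa using this
  have s31 : 2 * |a31| ≤ |p3| + |p3 - 2*a31| := by
    have := abs_sub p3 (p3 - 2*a31)
    rw [show p3 - (p3 - 2*a31) = 2 * a31 by ring, abs_mul] at this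
    simpa using this
  have d13 := abs_le.1 (abs_abs_sub_abs_le_abs_sub (p1 - (a11+a12+a13)) (p1 - (a11+a12-a13)))
  rw [show p1 - (a11+a12+a13) - (p1 - (a11+a12-a13)) = -(2 * a13) by ring, abs_neg, abs_mul,
    abs_two] at d13
  have d31 := abs_le.1 (abs_abs_sub_abs_le_abs_sub (p3 - 2*a31) p3)
  rw [show (p3 - 2*a31) - p3 = -(2 * a31) by ring, abs_neg, abs_mul, abs_two] at d31
  have b11 := abs_le.1 h11
  have b12 := abs_le.1 h12
  have b13 := abs_le.1 h13
  have b21 := abs_le.1 h21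
  have b22 := abs_le.1 h22
  have b23 := abs_le.1 h23
  have b31 := abs_le.1 h31
  have b32 := abs_le.1 h32
  have b33 := abs_le.1 h33
  have P1 : |p1| ≤ 3/100 := abs_le.2 ⟨by linarith [d31.1], by linarith [d31.2]⟩
  have P3 : |p3| ≤ 4/100 := abs_le.2 ⟨by linarith [d13.1], by linarith [d13.2]⟩
  have c1 := abs_le.1 P1
  have c3 := abs_le.1 P3
  have U1 : |p1 - (a11+a12+a13)| ≤ 6/100 := abs_le.2 ⟨by linarith, by linarith⟩
  have P2 : |p2| ≤ 12/100 := abs_le.2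
    ⟨by linarith [abs_nonneg (p1 - (a11+a12+a13))], by linarith [abs_nonneg p3]⟩
  -- the common value
  have F : 0 < p1 + p2 + |p3| := by linarith
  obtain ⟨m1, m2, m3, k2, k3, hm⟩ := H (1 + p1) (1/2 + p2) (0 + p3)
  by_cases n1 : m1 = 0 ∧ m2 = 0 ∧ m3 = 0
  · obtain ⟨rfl, rfl, rfl⟩ := n1
    push_cast at hm
    have r1 := le_abs_self (1 + p1 - (0 + (a11 * 0 + a12 * 0 + a13 * 0)))
    have r2 := le_abs_self (1/2 + p2 - (0 + (a21 * 0 + a22 * 0 + a23 * 0)))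
    have r3 : 0 + p3 - (0 + (a31 * 0 + a32 * 0 + a33 * 0)) = p3 := by ring
    rw [r3] at hm
    linarith
  by_cases n2 : m1 = 1 ∧ m2 = 1 ∧ m3 = 1
  · obtain ⟨rfl, rfl, rfl⟩ := n2
    push_cast at hm
    have r1 : 1 + p1 - (1 + (a11 * 1 + a12 * 1 + a13 * 1)) = p1 - (a11+a12+a13) := by ring
    have r2 := neg_le_abs (1/2 + p2 - (1 + (a21 * 1 + a22 * 1 + a23 * 1)))
    have r3 := neg_le_abs (0 + p3 - (1 + (a31 * 1 + a32 * 1 + a33 * 1)))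
    rw [r1] at hm
    linarith
  by_cases n3 : m1 = 2 ∧ m2 = 0 ∧ m3 = 0
  · obtain ⟨rfl, rfl, rfl⟩ := n3
    push_cast at hm
    have r1 := neg_le_abs (1 + p1 - (2 + (a11 * 2 + a12 * 0 + a13 * 0)))
    have r2 := le_abs_self (1/2 + p2 - (0 + (a21 * 2 + a22 * 0 + a23 * 0)))
    have r3 : 0 + p3 - (0 + (a31 * 2 + a32 * 0 + a33 * 0)) = p3 - 2 * a31 := by ring
    rw [r3] at hm
    linarith
  by_cases n4 : m1 = 1 ∧ m2 = 1 ∧ m3 = -1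
  · obtain ⟨rfl, rfl, rfl⟩ := n4
    push_cast at hm
    have r1 : 1 + p1 - (1 + (a11 * 1 + a12 * 1 + a13 * -1)) = p1 - (a11+a12-a13) := by ring
    have r2 := neg_le_abs (1/2 + p2 - (1 + (a21 * 1 + a22 * 1 + a23 * -1)))
    have r3 := le_abs_self (0 + p3 - (-1 + (a31 * 1 + a32 * 1 + a33 * -1)))
    rw [r1] at hm
    linarith
  have far := bcc_far m1 m2 m3 k2 k3 n1 n2 n3 n4
  have far' : (5:ℝ) ≤ |2 - 2 * (m1:ℝ)| + |1 - 2 * (m2:ℝ)| + |2 * (m3:ℝ)| := by exact_mod_cast far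
  rw [show 2 - 2 * (m1:ℝ) = 2 * (1 - m1) by ring, show 1 - 2 * (m2:ℝ) = 2 * (1/2 - m2) by ring,
    show 2 * (m3:ℝ) = (-2) * (0 - m3) by ring, abs_mul, abs_mul, abs_mul, abs_neg, abs_two] at far'
  have t1 := abs_tri 1 p1 m1 (a11 * m1 + a12 * m2 + a13 * m3)
  have t2 := abs_tri (1/2) p2 m2 (a21 * m1 + a22 * m2 + a23 * m3)
  have t3 := abs_tri 0 p3 m3 (a31 * m1 + a32 * m2 + a33 * m3)
  have g1 := abs_comb a11 a12 a13 m1 m2 m3 _ h11 h12 h13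
  have g2 := abs_comb a21 a22 a23 m1 m2 m3 _ h21 h22 h23
  have g3 := abs_comb a31 a32 a33 m1 m2 m3 _ h31 h32 h33
  have l1 := abs_sub_abs_le_abs_sub (m1:ℝ) 1
  have l2 := abs_sub_abs_le_abs_sub (m2:ℝ) (1/2)
  have l3 := abs_sub_abs_le_abs_sub (m3:ℝ) 0
  rw [abs_sub_comm (m1:ℝ) 1, abs_one] at l1
  rw [abs_sub_comm (m2:ℝ) (1/2), abs_of_pos (by norm_num : (0:ℝ) < 1/2)] at l2
  rw [abs_sub_comm (m3:ℝ) 0, abs_zero] at l3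
  linarith

lemma mul_le_sq_quarter {a b t : ℝ} (h : |a| + |b| ≤ t) : -(a * b) ≤ t ^ 2 / 4 ∧ |a * b| ≤ t^2/4 := by
  have : |a * b| ≤ t^2/4 := by
    rw [abs_mul]
    nlinarith [sq_nonneg (|a| - |b|), abs_nonneg a, abs_nonneg b]
  exact ⟨le_trans (neg_le_abs _) this, this⟩

lemma triple_le {a b c t : ℝ} (ha : |a| ≤ t) (hb : |b| ≤ t) (hc : |c| ≤ t) (h : t ≤ 3/100) :
    |a * b * c| ≤ 3/100 * t^2 := by
  rw [abs_mul, abs_mul]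
  have h1 : |a| * |b| ≤ t * t := mul_le_mul ha hb (abs_nonneg _) (le_trans (abs_nonneg _) ha)
  have h2 : |a| * |b| * |c| ≤ t * t * (3/100) :=
    mul_le_mul h1 (hc.trans h) (abs_nonneg _) (mul_self_nonneg t)
  linarith

lemma amgm3 (a b c : ℝ) (ha : |a| ≤ 1/100) (hb : |b| ≤ 1/100) (hc : |c| ≤ 1/100) :
    (1+a)*(1+b)*(1+c) ≤ 1 + (a+b+c) + (a+b+c)^2 - (a^2+b^2+c^2)/4 := by
  have h1 := abs_le.1 ha
  have h2 := abs_le.1 hb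
  have h3 := abs_le.1 hc
  have : a * b * c ≤ (a^2 + b^2)/200 := by
    have : |a*b| * |c| ≤ (a^2+b^2)/2 * (1/100) := by
      apply mul_le_mul _ hc (abs_nonneg _) (by positivity)
      exact abs_le.2 ⟨by nlinarith [sq_nonneg (a+b)], by nlinarith [sq_nonneg (a-b)]⟩
    rw [← abs_mul] at this
    linarith [le_abs_self (a*b*c)]
  nlinarith [sq_nonneg (a+b+c), sq_nonneg c]

lemma det_final (a11 a12 a13 a21 a22 a23 a31 a32 a33 D : ℝ)
    (h11 : |a11| ≤ 1/100) (h22 : |a22| ≤ 1/100) (h33 : |a33| ≤ 1/100)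
    (k1 : |a13| + |a31| + (a11 + a22 + a33) ≤ 0)
    (k2 : |a12| + |a21| + (a11 + a22 + a33) ≤ 0)
    (k3 : |a23| + |a32| + (a11 + a22 + a33) ≤ 0)
    (hD : D = (1+a11)*(1+a22)*(1+a33) + a12*a23*a31 + a13*a21*a32 - (1+a11)*(a23*a32)
      - (1+a22)*(a13*a31) - (1+a33)*(a12*a21)) :
    |D| ≤ 1 ∧ (|D| = 1 → a11 = 0 ∧ a12 = 0 ∧ a13 = 0 ∧ a21 = 0 ∧ a22 = 0 ∧ a23 = 0 ∧
      a31 = 0 ∧ a32 = 0 ∧ a33 = 0) := by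
  obtain ⟨t, ht⟩ : ∃ t, t = -(a11 + a22 + a33) := ⟨_, rfl⟩
  have z12 := abs_nonneg a12
  have z13 := abs_nonneg a13
  have z21 := abs_nonneg a21
  have z23 := abs_nonneg a23
  have z31 := abs_nonneg a31
  have z32 := abs_nonneg a32
  have b11 := abs_le.1 h11
  have b22 := abs_le.1 h22
  have b33 := abs_le.1 h33
  have t0 : 0 ≤ t := by linarith
  have t1 : t ≤ 3/100 := by linarith
  have q1 := (mul_le_sq_quarter (show |a13| + |a31| ≤ t by linarith)).2
  have q2 := (mul_le_sq_quarter (show |a12| + |a21| ≤ t by linarith)).2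
  have q3 := (mul_le_sq_quarter (show |a23| + |a32| ≤ t by linarith)).2
  have r1 := triple_le (show |a12| ≤ t by linarith) (show |a23| ≤ t by linarith)
    (show |a31| ≤ t by linarith) t1
  have r2 := triple_le (show |a13| ≤ t by linarith) (show |a21| ≤ t by linarith)
    (show |a32| ≤ t by linarith) t1
  have s : ∀ d x : ℝ, |d| ≤ 1/100 → |x| ≤ t^2/4 → |(1+d)*x| ≤ t^2/2 := by
    intro d x hd hx
    rw [abs_mul]
    have : |1+d| ≤ 2 := by
      have := abs_le.1 hd
      exact abs_le.2 ⟨by linarith, by linarith⟩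
    have := mul_le_mul this hx (abs_nonneg _) (by norm_num)
    linarith
  have s1 := abs_le.1 (s _ _ h11 q3)
  have s2 := abs_le.1 (s _ _ h22 q1)
  have s3 := abs_le.1 (s _ _ h33 q2)
  replace r1 := abs_le.1 r1
  replace r2 := abs_le.1 r2
  have am := amgm3 a11 a22 a33 h11 h22 h33
  have e2 : (a11+a22+a33)^2 = t^2 := by rw [ht]; ring
  have tt : t^2 ≤ 3/100 * t := by nlinarith
  have up : D ≤ 1 - t/2 - (a11^2+a22^2+a33^2)/4 := by linarith
  have lo : 0 ≤ D := by
    have : (1/2:ℝ) ≤ (1+a11)*(1+a22)*(1+a33) := by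
      have x1 : (99/100:ℝ)*(99/100) ≤ (1+a11)*(1+a22) :=
        mul_le_mul (by linarith) (by linarith) (by norm_num) (by linarith)
      have x2 : (99/100:ℝ)*(99/100)*(99/100) ≤ (1+a11)*(1+a22)*(1+a33) :=
        mul_le_mul x1 (by linarith) (by norm_num) (by linarith)
      linarith
    linarith
  rw [abs_of_nonneg lo]
  have w1 := sq_nonneg a11
  have w2 := sq_nonneg a22
  have w3 := sq_nonneg a33
  refine ⟨by linarith, fun h => ?_⟩
  have T : t = 0 := by linarith
  have o : ∀ x : ℝ, |x| ≤ 0 → x = 0 := fun x hx => abs_nonpos_iff.1 hx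
  have o' : ∀ x : ℝ, x ^ 2 ≤ 0 → x = 0 := fun x hx => pow_eq_zero_iff two_ne_zero |>.1
    (le_antisymm hx (sq_nonneg x))
  refine ⟨o' _ ?_, o _ ?_, o _ ?_, o _ ?_, o' _ ?_, o _ ?_, o _ ?_, o _ ?_, o' _ ?_⟩ <;> linarith

lemma bcc_cover (y : ℝ) : ∃ (k : ℤ) (r : ℝ), y = 2 * k + r ∧ |r| ≤ 1 := by
  refine ⟨round (y/2), y - 2 * round (y/2), by ring, ?_⟩
  have := abs_sub_round (y/2)
  rw [show y - 2 * (round (y/2) : ℝ) = 2 * (y/2 - round (y/2)) by ring, abs_mul, abs_two]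
  linarith

lemma odd_adj (r : ℝ) (hr : |r| ≤ 1) : ∃ s : ℤ, (s = 1 ∨ s = -1) ∧ |r - s| = 1 - |r| := by
  rcases abs_cases r with ⟨h, h'⟩ | ⟨h, h'⟩
  · refine ⟨1, Or.inl rfl, ?_⟩
    push_cast
    rw [abs_sub_comm, abs_of_nonneg (by linarith), h]
  · refine ⟨-1, Or.inr rfl, ?_⟩
    push_cast
    rw [abs_of_nonneg (by linarith), h]; ring

lemma bcc_cov0 (y1 y2 y3 : ℝ) : ∃ m1 m2 m3 : ℤ, (2:ℤ) ∣ m1 - m2 ∧ (2:ℤ) ∣ m1 - m3 ∧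
    |y1 - m1| + |y2 - m2| + |y3 - m3| ≤ 3/2 := by
  obtain ⟨k1, r1, rfl, h1⟩ := bcc_cover y1
  obtain ⟨k2, r2, rfl, h2⟩ := bcc_cover y2
  obtain ⟨k3, r3, rfl, h3⟩ := bcc_cover y3
  by_cases h : |r1| + |r2| + |r3| ≤ 3/2
  · refine ⟨2*k1, 2*k2, 2*k3, by omega, by omega, ?_⟩
    push_cast
    simpa using h
  · obtain ⟨s1, c1, e1⟩ := odd_adj r1 h1
    obtain ⟨s2, c2, e2⟩ := odd_adj r2 h2
    obtain ⟨s3, c3, e3⟩ := odd_adj r3 h3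
    refine ⟨2*k1+s1, 2*k2+s2, 2*k3+s3, by omega, by omega, ?_⟩
    push_cast
    rw [add_sub_add_left_eq_sub, add_sub_add_left_eq_sub, add_sub_add_left_eq_sub, e1, e2, e3]
    linarith

lemma mem_bcc (m1 m2 m3 : ℤ) (h12 : (2:ℤ) ∣ m1 - m2) (h13 : (2:ℤ) ∣ m1 - m3) :
    (![(m1:ℝ), m2, m3]) ∈ AddSubgroup.closure
        ({![1, 1, 1], ![1, -1, 1], ![1, 1, -1]} : Set (Fin 3 → ℝ)) := by
  obtain ⟨a, ha⟩ := h12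
  obtain ⟨b, hb⟩ := h13
  obtain rfl : m2 = m1 - 2 * a := by omega
  obtain rfl : m3 = m1 - 2 * b := by omega
  have e : (![(m1:ℝ), ((m1 - 2 * a : ℤ) : ℝ), ((m1 - 2 * b : ℤ) : ℝ)]) =
      (m1 - a - b) • ![(1:ℝ), 1, 1] + a • ![(1:ℝ), -1, 1] + b • ![(1:ℝ), 1, -1] := by
    ext i
    fin_cases i <;> simp <;> ring
  rw [e]
  refine add_mem (add_mem (zsmul_mem ?_ _) (zsmul_mem ?_ _)) (zsmul_mem ?_ _) <;>
    exact AddSubgroup.subset_closure (by simp)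

lemma closure_form (w1 w2 w3 x : Fin 3 → ℝ)
    (hx : x ∈ AddSubgroup.closure ({w1, w2, w3} : Set (Fin 3 → ℝ))) :
    ∃ n1 n2 n3 : ℤ, ∀ i, x i = n1 * w1 i + n2 * w2 i + n3 * w3 i := by
  induction hx using AddSubgroup.closure_induction with
  | mem x hx =>
    rcases hx with rfl | rfl | rfl
    · exact ⟨1, 0, 0, by intro i; simp⟩
    · exact ⟨0, 1, 0, by intro i; simp⟩
    · exact ⟨0, 0, 1, by intro i; simp⟩
  | zero => exact ⟨0, 0, 0, by intro i; simp⟩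
  | add x y _ _ hx hy =>
    obtain ⟨a, b, c, h⟩ := hx
    obtain ⟨a', b', c', h'⟩ := hy
    refine ⟨a + a', b + b', c + c', fun i => ?_⟩
    rw [Pi.add_apply, h, h']; push_cast; ring
  | neg x _ hx =>
    obtain ⟨a, b, c, h⟩ := hx
    refine ⟨-a, -b, -c, fun i => ?_⟩
    rw [Pi.neg_apply, h]; push_cast; ring

lemma cov_of (w1 w2 w3 : Fin 3 → ℝ)
    (H : ∀ y : Fin 3 → ℝ, ∃ b : Fin 3 → ℝ, (∑ i, |b i|) ≤ 3 / 2 ∧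
          y - b ∈ AddSubgroup.closure ({w1, w2, w3} : Set (Fin 3 → ℝ))) :
    BccCov ((w2 0 + w3 0)/2 - 1) ((w1 0 - w2 0)/2) ((w1 0 - w3 0)/2)
      ((w2 1 + w3 1)/2) ((w1 1 - w2 1)/2 - 1) ((w1 1 - w3 1)/2)
      ((w2 2 + w3 2)/2) ((w1 2 - w2 2)/2) ((w1 2 - w3 2)/2 - 1) := by
  intro y1 y2 y3
  obtain ⟨b, hb, hm⟩ := H ![y1, y2, y3]
  obtain ⟨n1, n2, n3, h⟩ := closure_form _ _ _ _ hm
  refine ⟨n1+n2+n3, n1-n2+n3, n1+n2-n3, by omega, by omega, ?_⟩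
  have h0 := h 0
  have h1 := h 1
  have h2 := h 2
  simp at h0 h1 h2
  rw [Fin.sum_univ_three] at hb
  push_cast
  convert hb using 3
  · congr 1; linear_combination h0
  · congr 1; linear_combination h1
  · congr 1; linear_combination h2

lemma BccCov.swap12 {a11 a12 a13 a21 a22 a23 a31 a32 a33 : ℝ}
    (H : BccCov a11 a12 a13 a21 a22 a23 a31 a32 a33) :
    BccCov a22 a21 a23 a12 a11 a13 a32 a31 a33 := by
  intro y1 y2 y3
  obtain ⟨m1, m2, m3, h1, h2, h⟩ := H y2 y1 y3
  refine ⟨m2, m1, m3, by omega, by omega, le_trans (le_of_eq ?_) h⟩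
  rw [add_comm (a11 * (m1:ℝ)), add_comm (a21 * (m1:ℝ)), add_comm (a31 * (m1:ℝ))]
  ring

lemma BccCov.swap23 {a11 a12 a13 a21 a22 a23 a31 a32 a33 : ℝ}
    (H : BccCov a11 a12 a13 a21 a22 a23 a31 a32 a33) :
    BccCov a11 a13 a12 a31 a33 a32 a21 a23 a22 := by
  intro y1 y2 y3
  obtain ⟨m1, m2, m3, h1, h2, h⟩ := H y1 y3 y2
  refine ⟨m1, m3, m2, by omega, by omega, le_trans (le_of_eq ?_) h⟩
  rw [add_right_comm (a11 * (m1:ℝ)), add_right_comm (a21 * (m1:ℝ)), add_right_comm (a31 * (m1:ℝ))]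
  ring

/-- The vectors `(1,1,1)`, `(1,−1,1)`, `(1,1,−1)` generate the
body-centered cubic lattice `L_bcc`; the octahedra `B_{3,3/2} + L_bcc` cover `ℝ³`
and `|det| = 4`. Moreover `L_bcc` is locally optimal among lattices `L` with
`B_{3,3/2} + L = ℝ³`: for nearby generating triples giving such a covering, the
absolute determinant is at most `4`, with equality only for the original triple. -/
theorem stmt15 :
    (∀ y : Fin 3 → ℝ, ∃ b : Fin 3 → ℝ, (∑ i, |b i|) ≤ 3 / 2 ∧
      y - b ∈ AddSubgroup.closure
        ({![1, 1, 1], ![1, -1, 1], ![1, 1, -1]} : Set (Fin 3 → ℝ))) ∧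
    |(Matrix.of ![![(1 : ℝ), 1, 1], ![1, -1, 1], ![1, 1, -1]]).det| = 4 ∧
    ∃ U ∈ nhds ((![1, 1, 1], ![1, -1, 1], ![1, 1, -1]) :
        (Fin 3 → ℝ) × (Fin 3 → ℝ) × (Fin 3 → ℝ)),
      ∀ w : (Fin 3 → ℝ) × (Fin 3 → ℝ) × (Fin 3 → ℝ), w ∈ U →
        (∀ y : Fin 3 → ℝ, ∃ b : Fin 3 → ℝ, (∑ i, |b i|) ≤ 3 / 2 ∧
          y - b ∈ AddSubgroup.closure ({w.1, w.2.1, w.2.2} : Set (Fin 3 → ℝ))) →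
        |(Matrix.of ![w.1, w.2.1, w.2.2]).det| ≤ 4 ∧
          (|(Matrix.of ![w.1, w.2.1, w.2.2]).det| = 4 →
            w = (![1, 1, 1], ![1, -1, 1], ![1, 1, -1])) := by
  refine ⟨?_, ?_, ?_⟩
  · intro y
    obtain ⟨m1, m2, m3, h1, h2, h⟩ := bcc_cov0 (y 0) (y 1) (y 2)
    refine ⟨y - ![(m1:ℝ), m2, m3], ?_, ?_⟩
    · rw [Fin.sum_univ_three]
      simpa using h
    · rw [sub_sub_cancel]
      exact mem_bcc m1 m2 m3 h1 h2
  · rw [Matrix.det_fin_three]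
    simp
    norm_num
  · refine ⟨_, Metric.ball_mem_nhds _ (show (0:ℝ) < 1/200 by norm_num), ?_⟩
    rintro ⟨w1, w2, w3⟩ hw H
    simp only at H ⊢
    rw [Metric.mem_ball, Prod.dist_eq, Prod.dist_eq, max_lt_iff, max_lt_iff] at hw
    obtain ⟨d1, d2, d3⟩ := hw
    rw [dist_pi_lt_iff (by norm_num)] at d1 d2 d3
    simp only [Fin.forall_fin_succ, Real.dist_eq, abs_lt] at d1 d2 d3
    simp at d1 d2 d3
    obtain ⟨⟨x1, x2⟩, ⟨x3, x4⟩, ⟨x5, x6⟩⟩ := d1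
    obtain ⟨⟨y1, y2⟩, ⟨y3, y4⟩, ⟨y5, y6⟩⟩ := d2
    obtain ⟨⟨z1, z2⟩, ⟨z3, z4⟩, ⟨z5, z6⟩⟩ := d3
    have C := cov_of w1 w2 w3 H
    have h11 : |(w2 0 + w3 0)/2 - 1| ≤ 1/100 := abs_le.2 ⟨by linarith, by linarith⟩
    have h12 : |(w1 0 - w2 0)/2| ≤ 1/100 := abs_le.2 ⟨by linarith, by linarith⟩
    have h13 : |(w1 0 - w3 0)/2| ≤ 1/100 := abs_le.2 ⟨by linarith, by linarith⟩
    have h21 : |(w2 1 + w3 1)/2| ≤ 1/100 := abs_le.2 ⟨by linarith, by linarith⟩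
    have h22 : |(w1 1 - w2 1)/2 - 1| ≤ 1/100 := abs_le.2 ⟨by linarith, by linarith⟩
    have h23 : |(w1 1 - w3 1)/2| ≤ 1/100 := abs_le.2 ⟨by linarith, by linarith⟩
    have h31 : |(w2 2 + w3 2)/2| ≤ 1/100 := abs_le.2 ⟨by linarith, by linarith⟩
    have h32 : |(w1 2 - w2 2)/2| ≤ 1/100 := abs_le.2 ⟨by linarith, by linarith⟩
    have h33 : |(w1 2 - w3 2)/2 - 1| ≤ 1/100 := abs_le.2 ⟨by linarith, by linarith⟩
    have k1 := cov_key _ _ _ _ _ _ _ _ _ h11 h12 h13 h21 h22 h23 h31 h32 h33 C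
    have k2 := cov_key _ _ _ _ _ _ _ _ _ h11 h13 h12 h31 h33 h32 h21 h23 h22 C.swap23
    have k3 := cov_key _ _ _ _ _ _ _ _ _ h22 h21 h23 h12 h11 h13 h32 h31 h33 C.swap12
    have dd : (Matrix.of ![w1, w2, w3]).det = 4 * ((Matrix.of ![w1, w2, w3]).det / 4) := by ring
    have fin := det_final ((w2 0 + w3 0)/2 - 1) ((w1 0 - w2 0)/2) ((w1 0 - w3 0)/2)
      ((w2 1 + w3 1)/2) ((w1 1 - w2 1)/2 - 1) ((w1 1 - w3 1)/2)
      ((w2 2 + w3 2)/2) ((w1 2 - w2 2)/2) ((w1 2 - w3 2)/2 - 1) ((Matrix.of ![w1, w2, w3]).det / 4) h11 h22 h33 k1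
      (by linarith) (by linarith) (by
        rw [Matrix.det_fin_three]
        simp
        ring)
    rw [abs_div, abs_of_pos (show (0:ℝ) < 4 by norm_num)] at fin
    refine ⟨by linarith [fin.1], fun h => ?_⟩
    obtain ⟨g1, g2, g3, g4, g5, g6, g7, g8, g9⟩ := fin.2 (by rw [h]; norm_num)
    refine Prod.ext ?_ (Prod.ext ?_ ?_) <;> ext i <;> fin_cases i <;> simp <;> linarith
end

section
/- (Forcade–Lamoreaux) Let v_1 = (−2,2,2), v_2 = (3,−3,3), v_3 = (4,3,−1), which generate the lattice L'_7, and note that T_{3,10} + L'_7 = ℝ³ with |det(v_1,v_2,v_3)| = 84. Then L'_7 is locally optimal among lattices L with T_{3,10} + L = ℝ³: there is a neighborhood U of (v_1,v_2,v_3) in (ℝ³)³ such that for all (v'_1,v'_2,v'_3) ∈ U, if the lattice L generated by v'_1,v'_2,v'_3 satisfies T_{3,10} + L = ℝ³, then |det(v'_1,v'_2,v'_3)| ≤ 84, with equality only when (v'_1,v'_2,v'_3) = (v_1,v_2,v_3). -/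
namespace FL

theorem residues : ∀ r : Fin 84, ∃ a b c : Fin 8, a.val + b.val + c.val ≤ 7 ∧
    (2 * a.val + 9 * b.val + 35 * c.val) % 84 = r.val := by
  decide +kernel

theorem mem_iff (u v w x : Fin 3 → ℝ) :
    x ∈ AddSubgroup.closure ({u, v, w} : Set (Fin 3 → ℝ)) ↔
      ∃ n m k : ℤ, ∀ i, x i = n * u i + m * v i + k * w i := by
  rw [← Submodule.span_int_eq_addSubgroupClosure, Submodule.mem_toAddSubgroup,
    Submodule.mem_span_triple]
  constructor
  · rintro ⟨n, m, k, h⟩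
    exact ⟨n, m, k, fun i => by rw [← h]; simp⟩
  · rintro ⟨n, m, k, h⟩
    refine ⟨n, m, k, ?_⟩
    ext i
    rw [h]; simp

theorem cover (y : Fin 3 → ℝ) : ∃ b : Fin 3 → ℝ, (∀ i, 0 ≤ b i) ∧ (∑ i, b i) ≤ 10 ∧
      y - b ∈ AddSubgroup.closure
        ({![(-2 : ℝ), 2, 2], ![3, -3, 3], ![4, 3, -1]} : Set (Fin 3 → ℝ)) := by
  obtain ⟨z0, h0⟩ : ∃ z, z = ⌊y 0⌋ := ⟨_, rfl⟩
  obtain ⟨z1, h1⟩ : ∃ z, z = ⌊y 1⌋ := ⟨_, rfl⟩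
  obtain ⟨z2, h2⟩ : ∃ z, z = ⌊y 2⌋ := ⟨_, rfl⟩
  have f0 := Int.floor_le (y 0)
  have f1 := Int.floor_le (y 1)
  have f2 := Int.floor_le (y 2)
  have g0 := Int.lt_floor_add_one (y 0)
  have g1 := Int.lt_floor_add_one (y 1)
  have g2 := Int.lt_floor_add_one (y 2)
  rw [← h0] at f0 g0
  rw [← h1] at f1 g1
  rw [← h2] at f2 g2
  obtain ⟨a, b, c, hs, hr⟩ := residues
    ⟨((2 * z0 + 9 * z1 + 35 * z2) % 84).toNat, by omega⟩
  simp only at hr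
  obtain ⟨a, ha⟩ := a
  obtain ⟨b, hb⟩ := b
  obtain ⟨c, hc⟩ := c
  simp only at hr hs
  obtain ⟨m, hm⟩ : ∃ m : ℤ, 2 * (z0 - a) + 9 * (z1 - b) + 35 * (z2 - c) = 84 * m :=
    ⟨(2 * (z0 - a) + 9 * (z1 - b) + 35 * (z2 - c)) / 84, by omega⟩
  obtain ⟨n1, hn1⟩ : ∃ n : ℤ, -6 * (z0 - a) + 15 * (z1 - b) + 21 * (z2 - c) = 84 * n :=
    ⟨(-6 * (z0 - a) + 15 * (z1 - b) + 21 * (z2 - c)) / 84, by omega⟩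
  obtain ⟨n2, hn2⟩ : ∃ n : ℤ, 8 * (z0 - a) - 6 * (z1 - b) + 14 * (z2 - c) = 84 * n :=
    ⟨(8 * (z0 - a) - 6 * (z1 - b) + 14 * (z2 - c)) / 84, by omega⟩
  obtain ⟨n3, hn3⟩ : ∃ n : ℤ, 12 * (z0 - a) + 12 * (z1 - b) = 84 * n :=
    ⟨(12 * (z0 - a) + 12 * (z1 - b)) / 84, by omega⟩
  have e0 : z0 - a = -2 * n1 + 3 * n2 + 4 * n3 := by omega
  have e1 : z1 - b = 2 * n1 - 3 * n2 + 3 * n3 := by omega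
  have e2 : z2 - c = 2 * n1 + 3 * n2 - n3 := by omega
  have e0' : (z0 : ℝ) - a = -2 * n1 + 3 * n2 + 4 * n3 := by exact_mod_cast e0
  have e1' : (z1 : ℝ) - b = 2 * n1 - 3 * n2 + 3 * n3 := by exact_mod_cast e1
  have e2' : (z2 : ℝ) - c = 2 * n1 + 3 * n2 - n3 := by exact_mod_cast e2
  have hs' : (a : ℝ) + b + c ≤ 7 := by exact_mod_cast hs
  have ha' : (0 : ℝ) ≤ a := Nat.cast_nonneg a
  have hb' : (0 : ℝ) ≤ b := Nat.cast_nonneg b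
  have hc' : (0 : ℝ) ≤ c := Nat.cast_nonneg c
  refine ⟨![y 0 - z0 + a, y 1 - z1 + b, y 2 - z2 + c], ?_, ?_, ?_⟩
  · intro i
    fin_cases i <;> simp <;> linarith
  · simp [Fin.sum_univ_three]; linarith
  · rw [mem_iff]
    refine ⟨n1, n2, n3, ?_⟩
    intro i
    fin_cases i <;> simp <;> linarith

theorem small {x y z d e f : ℝ} (hd : |d| ≤ 1 / 1000000) (he : |e| ≤ 1 / 1000000)
    (hf : |f| ≤ 1 / 1000000) :
    |x * d + y * e + z * f| ≤ (|x| + |y| + |z|) / 1000000 := by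
  have h1 := mul_le_mul_of_nonneg_left hd (abs_nonneg x)
  have h2 := mul_le_mul_of_nonneg_left he (abs_nonneg y)
  have h3 := mul_le_mul_of_nonneg_left hf (abs_nonneg z)
  have h4 := abs_add_three (x * d) (y * e) (z * f)
  rw [abs_mul, abs_mul, abs_mul] at h4
  linarith

theorem key {a0 a1 a2 b0 b1 b2 c0 c1 c2 : ℝ}
    (ha0 : |a0 + 2| ≤ 1 / 1000000) (ha1 : |a1 - 2| ≤ 1 / 1000000) (ha2 : |a2 - 2| ≤ 1 / 1000000)
    (hb0 : |b0 - 3| ≤ 1 / 1000000) (hb1 : |b1 + 3| ≤ 1 / 1000000) (hb2 : |b2 - 3| ≤ 1 / 1000000)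
    (hc0 : |c0 - 4| ≤ 1 / 1000000) (hc1 : |c1 - 3| ≤ 1 / 1000000) (hc2 : |c2 + 1| ≤ 1 / 1000000)
    (hcov : ∀ y0 y1 y2 : ℝ, ∃ n1 n2 n3 : ℤ, n1 * a0 + n2 * b0 + n3 * c0 ≤ y0 ∧
      n1 * a1 + n2 * b1 + n3 * c1 ≤ y1 ∧ n1 * a2 + n2 * b2 + n3 * c2 ≤ y2 ∧
      y0 + y1 + y2 - 10 ≤ (n1 * a0 + n2 * b0 + n3 * c0) + (n1 * a1 + n2 * b1 + n3 * c1)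
        + (n1 * a2 + n2 * b2 + n3 * c2))
    (Y0 Y1 Y2 p1 p2 p3 q1 q2 q3 r1 r2 r3 : ℤ)
    (h0 : Y0 ≤ 10) (h1 : Y1 ≤ 10) (h2 : Y2 ≤ 10)
    (hp : p1 * a0 + p2 * b0 + p3 * c0 ≤ Y0 + 1 / 10)
    (hq : q1 * a1 + q2 * b1 + q3 * c1 ≤ Y1 + 1 / 10)
    (hr : r1 * a2 + r2 * b2 + r3 * c2 ≤ Y2 + 1 / 10)
    (H : ∀ n1 n2 n3 : ℤ, -2 * n1 + 3 * n2 + 4 * n3 ≤ Y0 → 2 * n1 - 3 * n2 + 3 * n3 ≤ Y1 →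
      2 * n1 + 3 * n2 - n3 ≤ Y2 → 0 ≤ 2 * n1 + 3 * n2 + 6 * n3 →
      (n1 = 0 ∧ n2 = 0 ∧ n3 = 0) ∨ (n1 = p1 ∧ n2 = p2 ∧ n3 = p3) ∨
      (n1 = q1 ∧ n2 = q2 ∧ n3 = q3) ∨ (n1 = r1 ∧ n2 = r2 ∧ n3 = r3)) :
    (p1 * a0 + p2 * b0 + p3 * c0) + (q1 * a1 + q2 * b1 + q3 * c1) +
      (r1 * a2 + r2 * b2 + r3 * c2) ≤ 10 := by
  by_contra hcon
  push Not at hcon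
  obtain ⟨x, hx⟩ : ∃ x, x = p1 * a0 + p2 * b0 + p3 * c0 := ⟨_, rfl⟩
  obtain ⟨y, hy⟩ : ∃ y, y = q1 * a1 + q2 * b1 + q3 * c1 := ⟨_, rfl⟩
  obtain ⟨z, hz⟩ : ∃ z, z = r1 * a2 + r2 * b2 + r3 * c2 := ⟨_, rfl⟩
  rw [← hx, ← hy, ← hz] at hcon
  rw [← hx] at hp
  rw [← hy] at hq
  rw [← hz] at hr
  obtain ⟨n1, n2, n3, i0, i1, i2, i3⟩ := hcov (x - (x + y + z - 10) / 6) (y - (x + y + z - 10) / 6)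
    (z - (x + y + z - 10) / 6)
  have s0 := small (x := n1) (y := n2) (z := n3) ha0 hb0 hc0
  have s1 := small (x := n1) (y := n2) (z := n3) ha1 hb1 hc1
  have s2 := small (x := n1) (y := n2) (z := n3) ha2 hb2 hc2
  obtain ⟨N, hN⟩ : ∃ N : ℝ, N = |(n1 : ℝ)| + |(n2 : ℝ)| + |(n3 : ℝ)| := ⟨_, rfl⟩
  obtain ⟨d0, hd0⟩ : ∃ d, d = (n1 : ℝ) * (a0 + 2) + n2 * (b0 - 3) + n3 * (c0 - 4) := ⟨_, rfl⟩
  obtain ⟨d1, hd1⟩ : ∃ d, d = (n1 : ℝ) * (a1 - 2) + n2 * (b1 + 3) + n3 * (c1 - 3) := ⟨_, rfl⟩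
  obtain ⟨d2, hd2⟩ : ∃ d, d = (n1 : ℝ) * (a2 - 2) + n2 * (b2 - 3) + n3 * (c2 + 1) := ⟨_, rfl⟩
  rw [← hd0, ← hN, abs_le] at s0
  rw [← hd1, ← hN, abs_le] at s1
  rw [← hd2, ← hN, abs_le] at s2
  obtain ⟨s0, t0⟩ := s0
  obtain ⟨s1, t1⟩ := s1
  obtain ⟨s2, t2⟩ := s2
  have E0 : n1 * a0 + n2 * b0 + n3 * c0 = (-2 * n1 + 3 * n2 + 4 * n3) + d0 := by rw [hd0]; ring
  have E1 : n1 * a1 + n2 * b1 + n3 * c1 = (2 * n1 - 3 * n2 + 3 * n3) + d1 := by rw [hd1]; ring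
  have E2 : n1 * a2 + n2 * b2 + n3 * c2 = (2 * n1 + 3 * n2 - n3) + d2 := by rw [hd2]; ring
  have j0 := i0
  have j1 := i1
  have j2 := i2
  have j3 := i3
  rw [E0] at j0
  rw [E1] at j1
  rw [E2] at j2
  rw [E0, E1, E2] at j3
  have h0' : (Y0 : ℝ) ≤ 10 := by exact_mod_cast h0
  have h1' : (Y1 : ℝ) ≤ 10 := by exact_mod_cast h1
  have h2' : (Y2 : ℝ) ≤ 10 := by exact_mod_cast h2
  have hN0 : 0 ≤ N := by rw [hN]; positivity
  have B1 : |(n1 : ℝ)| ≤ 30 + N / 2000 := by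
    rw [abs_le]; constructor <;> linarith
  have B2 : |(n2 : ℝ)| ≤ 30 + N / 2000 := by
    rw [abs_le]; constructor <;> linarith
  have B3 : |(n3 : ℝ)| ≤ 30 + N / 2000 := by
    rw [abs_le]; constructor <;> linarith
  have B : N ≤ 100 := by linarith
  have K0 : -2 * n1 + 3 * n2 + 4 * n3 < Y0 + 1 := by
    have : (-2 * n1 + 3 * n2 + 4 * n3 : ℝ) < Y0 + 1 := by linarith
    exact_mod_cast this
  have K1 : 2 * n1 - 3 * n2 + 3 * n3 < Y1 + 1 := by
    have : (2 * n1 - 3 * n2 + 3 * n3 : ℝ) < Y1 + 1 := by linarith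
    exact_mod_cast this
  have K2 : 2 * n1 + 3 * n2 - n3 < Y2 + 1 := by
    have : (2 * n1 + 3 * n2 - n3 : ℝ) < Y2 + 1 := by linarith
    exact_mod_cast this
  have K3 : -1 < 2 * n1 + 3 * n2 + 6 * n3 := by
    have : (-1 : ℝ) < 2 * n1 + 3 * n2 + 6 * n3 := by linarith
    exact_mod_cast this
  rcases H n1 n2 n3 (by omega) (by omega) (by omega) (by omega) with
    ⟨u1, u2, u3⟩ | ⟨u1, u2, u3⟩ | ⟨u1, u2, u3⟩ | ⟨u1, u2, u3⟩
  · subst u1 u2 u3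
    simp only [Int.cast_zero, zero_mul, add_zero] at i3
    linarith
  · rw [u1, u2, u3, ← hx] at i0
    linarith
  · rw [u1, u2, u3, ← hy] at i1
    linarith
  · rw [u1, u2, u3, ← hz] at i2
    linarith

theorem int0 : ∀ n1 n2 n3 : ℤ, -2 * n1 + 3 * n2 + 4 * n3 ≤ 1 → 2 * n1 - 3 * n2 + 3 * n3 ≤ 1 →
      2 * n1 + 3 * n2 - n3 ≤ 8 → 0 ≤ 2 * n1 + 3 * n2 + 6 * n3 →
      (n1 = 0 ∧ n2 = 0 ∧ n3 = 0) ∨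
      (n1 = 1 ∧ n2 = 1 ∧ n3 = 0) ∨
      (n1 = 2 ∧ n2 = 1 ∧ n3 = 0) ∨
      (n1 = 2 ∧ n2 = 1 ∧ n3 = (-1)) := by
  intro n1 n2 n3 h0 h1 h2 h3
  have : -1 ≤ n3 := by omega
  have : n3 ≤ 1 := by omega
  have : -3 ≤ n1 := by omega
  have : n1 ≤ 3 := by omega
  interval_cases n3 <;> interval_cases n1 <;> omega

theorem int1 : ∀ n1 n2 n3 : ℤ, -2 * n1 + 3 * n2 + 4 * n3 ≤ 1 → 2 * n1 - 3 * n2 + 3 * n3 ≤ 2 →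
      2 * n1 + 3 * n2 - n3 ≤ 7 → 0 ≤ 2 * n1 + 3 * n2 + 6 * n3 →
      (n1 = 0 ∧ n2 = 0 ∧ n3 = 0) ∨
      (n1 = 1 ∧ n2 = 1 ∧ n3 = 0) ∨
      (n1 = 1 ∧ n2 = 0 ∧ n3 = 0) ∨
      (n1 = 2 ∧ n2 = 1 ∧ n3 = 0) := by
  intro n1 n2 n3 h0 h1 h2 h3
  have : -1 ≤ n3 := by omega
  have : n3 ≤ 1 := by omega
  have : -3 ≤ n1 := by omega
  have : n1 ≤ 3 := by omega
  interval_cases n3 <;> interval_cases n1 <;> omega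

theorem int2 : ∀ n1 n2 n3 : ℤ, -2 * n1 + 3 * n2 + 4 * n3 ≤ 1 → 2 * n1 - 3 * n2 + 3 * n3 ≤ 7 →
      2 * n1 + 3 * n2 - n3 ≤ 2 → 0 ≤ 2 * n1 + 3 * n2 + 6 * n3 →
      (n1 = 0 ∧ n2 = 0 ∧ n3 = 0) ∨
      (n1 = 0 ∧ n2 = (-1) ∧ n3 = 1) ∨
      (n1 = 2 ∧ n2 = (-1) ∧ n3 = 0) ∨
      (n1 = 1 ∧ n2 = 0 ∧ n3 = 0) := by
  intro n1 n2 n3 h0 h1 h2 h3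
  have : -1 ≤ n3 := by omega
  have : n3 ≤ 1 := by omega
  have : -3 ≤ n1 := by omega
  have : n1 ≤ 3 := by omega
  interval_cases n3 <;> interval_cases n1 <;> omega

theorem int3 : ∀ n1 n2 n3 : ℤ, -2 * n1 + 3 * n2 + 4 * n3 ≤ 1 → 2 * n1 - 3 * n2 + 3 * n3 ≤ 8 →
      2 * n1 + 3 * n2 - n3 ≤ 1 → 0 ≤ 2 * n1 + 3 * n2 + 6 * n3 →
      (n1 = 0 ∧ n2 = 0 ∧ n3 = 0) ∨
      (n1 = 0 ∧ n2 = (-1) ∧ n3 = 1) ∨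
      (n1 = 1 ∧ n2 = (-1) ∧ n3 = 1) ∨
      (n1 = 2 ∧ n2 = (-1) ∧ n3 = 0) := by
  intro n1 n2 n3 h0 h1 h2 h3
  have : -1 ≤ n3 := by omega
  have : n3 ≤ 1 := by omega
  have : -3 ≤ n1 := by omega
  have : n1 ≤ 3 := by omega
  interval_cases n3 <;> interval_cases n1 <;> omega

theorem int4 : ∀ n1 n2 n3 : ℤ, -2 * n1 + 3 * n2 + 4 * n3 ≤ 2 → 2 * n1 - 3 * n2 + 3 * n3 ≤ 6 →
      2 * n1 + 3 * n2 - n3 ≤ 2 → 0 ≤ 2 * n1 + 3 * n2 + 6 * n3 →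
      (n1 = 0 ∧ n2 = 0 ∧ n3 = 0) ∨
      (n1 = 1 ∧ n2 = 0 ∧ n3 = 1) ∨
      (n1 = 0 ∧ n2 = (-1) ∧ n3 = 1) ∨
      (n1 = 1 ∧ n2 = 0 ∧ n3 = 0) := by
  intro n1 n2 n3 h0 h1 h2 h3
  have : -1 ≤ n3 := by omega
  have : n3 ≤ 1 := by omega
  have : -3 ≤ n1 := by omega
  have : n1 ≤ 3 := by omega
  interval_cases n3 <;> interval_cases n1 <;> omega

theorem int5 : ∀ n1 n2 n3 : ℤ, -2 * n1 + 3 * n2 + 4 * n3 ≤ 3 → 2 * n1 - 3 * n2 + 3 * n3 ≤ 2 →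
      2 * n1 + 3 * n2 - n3 ≤ 5 → 0 ≤ 2 * n1 + 3 * n2 + 6 * n3 →
      (n1 = 0 ∧ n2 = 0 ∧ n3 = 0) ∨
      (n1 = 0 ∧ n2 = 1 ∧ n3 = 0) ∨
      (n1 = 1 ∧ n2 = 0 ∧ n3 = 0) ∨
      (n1 = 1 ∧ n2 = 1 ∧ n3 = 0) := by
  intro n1 n2 n3 h0 h1 h2 h3
  have : -1 ≤ n3 := by omega
  have : n3 ≤ 1 := by omega
  have : -3 ≤ n1 := by omega
  have : n1 ≤ 3 := by omega
  interval_cases n3 <;> interval_cases n1 <;> omega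

theorem int6 : ∀ n1 n2 n3 : ℤ, -2 * n1 + 3 * n2 + 4 * n3 ≤ 3 → 2 * n1 - 3 * n2 + 3 * n3 ≤ 5 →
      2 * n1 + 3 * n2 - n3 ≤ 2 → 0 ≤ 2 * n1 + 3 * n2 + 6 * n3 →
      (n1 = 0 ∧ n2 = 0 ∧ n3 = 0) ∨
      (n1 = (-1) ∧ n2 = (-1) ∧ n3 = 1) ∨
      (n1 = 1 ∧ n2 = 0 ∧ n3 = 1) ∨
      (n1 = 1 ∧ n2 = 0 ∧ n3 = 0) := by
  intro n1 n2 n3 h0 h1 h2 h3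
  have : -1 ≤ n3 := by omega
  have : n3 ≤ 1 := by omega
  have : -3 ≤ n1 := by omega
  have : n1 ≤ 3 := by omega
  interval_cases n3 <;> interval_cases n1 <;> omega

theorem int7 : ∀ n1 n2 n3 : ℤ, -2 * n1 + 3 * n2 + 4 * n3 ≤ 3 → 2 * n1 - 3 * n2 + 3 * n3 ≤ 6 →
      2 * n1 + 3 * n2 - n3 ≤ 1 → 0 ≤ 2 * n1 + 3 * n2 + 6 * n3 →
      (n1 = 0 ∧ n2 = 0 ∧ n3 = 0) ∨
      (n1 = (-1) ∧ n2 = (-1) ∧ n3 = 1) ∨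
      (n1 = 0 ∧ n2 = (-1) ∧ n3 = 1) ∨
      (n1 = 1 ∧ n2 = 0 ∧ n3 = 1) := by
  intro n1 n2 n3 h0 h1 h2 h3
  have : -1 ≤ n3 := by omega
  have : n3 ≤ 1 := by omega
  have : -3 ≤ n1 := by omega
  have : n1 ≤ 3 := by omega
  interval_cases n3 <;> interval_cases n1 <;> omega

theorem int8 : ∀ n1 n2 n3 : ℤ, -2 * n1 + 3 * n2 + 4 * n3 ≤ 4 → 2 * n1 - 3 * n2 + 3 * n3 ≤ 4 →
      2 * n1 + 3 * n2 - n3 ≤ 2 → 0 ≤ 2 * n1 + 3 * n2 + 6 * n3 →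
      (n1 = 0 ∧ n2 = 0 ∧ n3 = 0) ∨
      (n1 = 0 ∧ n2 = 0 ∧ n3 = 1) ∨
      (n1 = (-1) ∧ n2 = (-1) ∧ n3 = 1) ∨
      (n1 = 1 ∧ n2 = 0 ∧ n3 = 0) := by
  intro n1 n2 n3 h0 h1 h2 h3
  have : -1 ≤ n3 := by omega
  have : n3 ≤ 1 := by omega
  have : -3 ≤ n1 := by omega
  have : n1 ≤ 3 := by omega
  interval_cases n3 <;> interval_cases n1 <;> omega

theorem int9 : ∀ n1 n2 n3 : ℤ, -2 * n1 + 3 * n2 + 4 * n3 ≤ 5 → 2 * n1 - 3 * n2 + 3 * n3 ≤ 2 →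
      2 * n1 + 3 * n2 - n3 ≤ 3 → 0 ≤ 2 * n1 + 3 * n2 + 6 * n3 →
      (n1 = 0 ∧ n2 = 0 ∧ n3 = 0) ∨
      (n1 = (-1) ∧ n2 = 1 ∧ n3 = 0) ∨
      (n1 = 1 ∧ n2 = 0 ∧ n3 = 0) ∨
      (n1 = 0 ∧ n2 = 1 ∧ n3 = 0) := by
  intro n1 n2 n3 h0 h1 h2 h3
  have : -1 ≤ n3 := by omega
  have : n3 ≤ 1 := by omega
  have : -3 ≤ n1 := by omega
  have : n1 ≤ 3 := by omega
  interval_cases n3 <;> interval_cases n1 <;> omega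

theorem int10 : ∀ n1 n2 n3 : ℤ, -2 * n1 + 3 * n2 + 4 * n3 ≤ 5 → 2 * n1 - 3 * n2 + 3 * n3 ≤ 3 →
      2 * n1 + 3 * n2 - n3 ≤ 2 → 0 ≤ 2 * n1 + 3 * n2 + 6 * n3 →
      (n1 = 0 ∧ n2 = 0 ∧ n3 = 0) ∨
      (n1 = (-1) ∧ n2 = 1 ∧ n3 = 0) ∨
      (n1 = 0 ∧ n2 = 0 ∧ n3 = 1) ∨
      (n1 = 1 ∧ n2 = 0 ∧ n3 = 0) := by
  intro n1 n2 n3 h0 h1 h2 h3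
  have : -1 ≤ n3 := by omega
  have : n3 ≤ 1 := by omega
  have : -3 ≤ n1 := by omega
  have : n1 ≤ 3 := by omega
  interval_cases n3 <;> interval_cases n1 <;> omega

theorem int11 : ∀ n1 n2 n3 : ℤ, -2 * n1 + 3 * n2 + 4 * n3 ≤ 6 → 2 * n1 - 3 * n2 + 3 * n3 ≤ 3 →
      2 * n1 + 3 * n2 - n3 ≤ 1 → 0 ≤ 2 * n1 + 3 * n2 + 6 * n3 →
      (n1 = 0 ∧ n2 = 0 ∧ n3 = 0) ∨
      (n1 = (-1) ∧ n2 = 0 ∧ n3 = 1) ∨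
      (n1 = 0 ∧ n2 = 0 ∧ n3 = 1) ∨
      (n1 = (-1) ∧ n2 = 1 ∧ n3 = 0) := by
  intro n1 n2 n3 h0 h1 h2 h3
  have : -1 ≤ n3 := by omega
  have : n3 ≤ 1 := by omega
  have : -3 ≤ n1 := by omega
  have : n1 ≤ 3 := by omega
  interval_cases n3 <;> interval_cases n1 <;> omega

theorem int12 : ∀ n1 n2 n3 : ℤ, -2 * n1 + 3 * n2 + 4 * n3 ≤ 8 → 2 * n1 - 3 * n2 + 3 * n3 ≤ 1 →
      2 * n1 + 3 * n2 - n3 ≤ 1 → 0 ≤ 2 * n1 + 3 * n2 + 6 * n3 →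
      (n1 = 0 ∧ n2 = 0 ∧ n3 = 0) ∨
      (n1 = (-2) ∧ n2 = 0 ∧ n3 = 1) ∨
      (n1 = (-1) ∧ n2 = 0 ∧ n3 = 1) ∨
      (n1 = (-1) ∧ n2 = 1 ∧ n3 = 0) := by
  intro n1 n2 n3 h0 h1 h2 h3
  have : -1 ≤ n3 := by omega
  have : n3 ≤ 1 := by omega
  have : -3 ≤ n1 := by omega
  have : n1 ≤ 3 := by omega
  interval_cases n3 <;> interval_cases n1 <;> omega

theorem constraints {a0 a1 a2 b0 b1 b2 c0 c1 c2 : ℝ}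
    (ha0 : |a0 + 2| ≤ 1 / 1000000) (ha1 : |a1 - 2| ≤ 1 / 1000000) (ha2 : |a2 - 2| ≤ 1 / 1000000)
    (hb0 : |b0 - 3| ≤ 1 / 1000000) (hb1 : |b1 + 3| ≤ 1 / 1000000) (hb2 : |b2 - 3| ≤ 1 / 1000000)
    (hc0 : |c0 - 4| ≤ 1 / 1000000) (hc1 : |c1 - 3| ≤ 1 / 1000000) (hc2 : |c2 + 1| ≤ 1 / 1000000)
    (hcov : ∀ y0 y1 y2 : ℝ, ∃ n1 n2 n3 : ℤ, n1 * a0 + n2 * b0 + n3 * c0 ≤ y0 ∧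
      n1 * a1 + n2 * b1 + n3 * c1 ≤ y1 ∧ n1 * a2 + n2 * b2 + n3 * c2 ≤ y2 ∧
      y0 + y1 + y2 - 10 ≤ (n1 * a0 + n2 * b0 + n3 * c0) + (n1 * a1 + n2 * b1 + n3 * c1)
        + (n1 * a2 + n2 * b2 + n3 * c2)) :
    a0 + 2 * a1 + 2 * a2 + b0 + b1 + b2 - c2 ≤ 10 ∧
    a0 + a1 + 2 * a2 + b0 + b2 ≤ 10 ∧
    2 * a1 + a2 - b0 - b1 + c0 ≤ 10 ∧
    a1 + 2 * a2 - b0 - b1 - b2 + c0 + c1 ≤ 10 ∧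
    a0 + a2 - b1 + c0 + c1 ≤ 10 ∧
    a1 + a2 + b0 + b2 ≤ 10 ∧
    -a0 + a1 + a2 - b0 + c0 + c1 ≤ 10 ∧
    -a0 + a2 - b0 - b1 + c0 + c1 + c2 ≤ 10 ∧
    -a1 + a2 - b1 + c0 + c1 ≤ 10 ∧
    -a0 + a1 + b0 + b2 ≤ 10 ∧
    -a0 + a2 + b0 + c1 ≤ 10 ∧
    -a0 - a2 + b2 + c0 + c1 ≤ 10 ∧
    -2 * a0 - a1 - a2 + b2 + c0 + c1 ≤ 10 := by
  have K := key ha0 ha1 ha2 hb0 hb1 hb2 hc0 hc1 hc2 hcov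
  rw [abs_le] at ha0 ha1 ha2 hb0 hb1 hb2 hc0 hc1 hc2
  obtain ⟨_, _⟩ := ha0
  obtain ⟨_, _⟩ := ha1
  obtain ⟨_, _⟩ := ha2
  obtain ⟨_, _⟩ := hb0
  obtain ⟨_, _⟩ := hb1
  obtain ⟨_, _⟩ := hb2
  obtain ⟨_, _⟩ := hc0
  obtain ⟨_, _⟩ := hc1
  obtain ⟨_, _⟩ := hc2
  refine ⟨?_, ?_, ?_, ?_, ?_, ?_, ?_, ?_, ?_, ?_, ?_, ?_, ?_⟩
  · have H := int0
    have := K 1 1 8 1 1 0 2 1 0 2 1 (-1) (by norm_num) (by norm_num) (by norm_num)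
      (by norm_num; linarith) (by norm_num; linarith) (by norm_num; linarith) H
    norm_num at this
    linarith
  · have H := int1
    have := K 1 2 7 1 1 0 1 0 0 2 1 0 (by norm_num) (by norm_num) (by norm_num)
      (by norm_num; linarith) (by norm_num; linarith) (by norm_num; linarith) H
    norm_num at this
    linarith
  · have H := int2
    have := K 1 7 2 0 (-1) 1 2 (-1) 0 1 0 0 (by norm_num) (by norm_num) (by norm_num)
      (by norm_num; linarith) (by norm_num; linarith) (by norm_num; linarith) H
    norm_num at this
    linarith
  · have H := int3
    have := K 1 8 1 0 (-1) 1 1 (-1) 1 2 (-1) 0 (by norm_num) (by norm_num) (by norm_num)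
      (by norm_num; linarith) (by norm_num; linarith) (by norm_num; linarith) H
    norm_num at this
    linarith
  · have H := int4
    have := K 2 6 2 1 0 1 0 (-1) 1 1 0 0 (by norm_num) (by norm_num) (by norm_num)
      (by norm_num; linarith) (by norm_num; linarith) (by norm_num; linarith) H
    norm_num at this
    linarith
  · have H := int5
    have := K 3 2 5 0 1 0 1 0 0 1 1 0 (by norm_num) (by norm_num) (by norm_num)
      (by norm_num; linarith) (by norm_num; linarith) (by norm_num; linarith) H
    norm_num at this
    linarith
  · have H := int6
    have := K 3 5 2 (-1) (-1) 1 1 0 1 1 0 0 (by norm_num) (by norm_num) (by norm_num)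
      (by norm_num; linarith) (by norm_num; linarith) (by norm_num; linarith) H
    norm_num at this
    linarith
  · have H := int7
    have := K 3 6 1 (-1) (-1) 1 0 (-1) 1 1 0 1 (by norm_num) (by norm_num) (by norm_num)
      (by norm_num; linarith) (by norm_num; linarith) (by norm_num; linarith) H
    norm_num at this
    linarith
  · have H := int8
    have := K 4 4 2 0 0 1 (-1) (-1) 1 1 0 0 (by norm_num) (by norm_num) (by norm_num)
      (by norm_num; linarith) (by norm_num; linarith) (by norm_num; linarith) H
    norm_num at this
    linarith
  · have H := int9
    have := K 5 2 3 (-1) 1 0 1 0 0 0 1 0 (by norm_num) (by norm_num) (by norm_num)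
      (by norm_num; linarith) (by norm_num; linarith) (by norm_num; linarith) H
    norm_num at this
    linarith
  · have H := int10
    have := K 5 3 2 (-1) 1 0 0 0 1 1 0 0 (by norm_num) (by norm_num) (by norm_num)
      (by norm_num; linarith) (by norm_num; linarith) (by norm_num; linarith) H
    norm_num at this
    linarith
  · have H := int11
    have := K 6 3 1 (-1) 0 1 0 0 1 (-1) 1 0 (by norm_num) (by norm_num) (by norm_num)
      (by norm_num; linarith) (by norm_num; linarith) (by norm_num; linarith) H
    norm_num at this
    linarith
  · have H := int12
    have := K 8 1 1 (-2) 0 1 (-1) 0 1 (-1) 1 0 (by norm_num) (by norm_num) (by norm_num)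
      (by norm_num; linarith) (by norm_num; linarith) (by norm_num; linarith) H
    norm_num at this
    linarith

set_option maxHeartbeats 2000000 in
theorem opt {a0 a1 a2 b0 b1 b2 c0 c1 c2 : ℝ}
    (ha0 : |a0 + 2| ≤ 1 / 1000000) (ha1 : |a1 - 2| ≤ 1 / 1000000) (ha2 : |a2 - 2| ≤ 1 / 1000000)
    (hb0 : |b0 - 3| ≤ 1 / 1000000) (hb1 : |b1 + 3| ≤ 1 / 1000000) (hb2 : |b2 - 3| ≤ 1 / 1000000)
    (hc0 : |c0 - 4| ≤ 1 / 1000000) (hc1 : |c1 - 3| ≤ 1 / 1000000) (hc2 : |c2 + 1| ≤ 1 / 1000000)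
    (hcov : ∀ y0 y1 y2 : ℝ, ∃ n1 n2 n3 : ℤ, n1 * a0 + n2 * b0 + n3 * c0 ≤ y0 ∧
      n1 * a1 + n2 * b1 + n3 * c1 ≤ y1 ∧ n1 * a2 + n2 * b2 + n3 * c2 ≤ y2 ∧
      y0 + y1 + y2 - 10 ≤ (n1 * a0 + n2 * b0 + n3 * c0) + (n1 * a1 + n2 * b1 + n3 * c1)
        + (n1 * a2 + n2 * b2 + n3 * c2))
    (D : ℝ) (hD : D = a0 * (b1 * c2 - b2 * c1) + a1 * (b2 * c0 - b0 * c2)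
      + a2 * (b0 * c1 - b1 * c0)) :
    |D| ≤ 84 ∧ (|D| = 84 → a0 = -2 ∧ a1 = 2 ∧ a2 = 2 ∧ b0 = 3 ∧ b1 = -3 ∧ b2 = 3 ∧
      c0 = 4 ∧ c1 = 3 ∧ c2 = -1) := by
  obtain ⟨k0, k1, k2, k3, k4, k5, k6, k7, k8, k9, k10, k11, k12⟩ :=
    constraints ha0 ha1 ha2 hb0 hb1 hb2 hc0 hc1 hc2 hcov
  clear hcov
  obtain ⟨t, ht⟩ : ∃ t, t = c2 + 1 := ⟨_, rfl⟩
  obtain ⟨x0, hx0⟩ : ∃ x, x = a0 + 2 := ⟨_, rfl⟩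
  obtain ⟨x1, hx1⟩ : ∃ x, x = a1 - 2 := ⟨_, rfl⟩
  obtain ⟨x2, hx2⟩ : ∃ x, x = a2 - 2 := ⟨_, rfl⟩
  obtain ⟨y0, hy0⟩ : ∃ x, x = b0 - 3 := ⟨_, rfl⟩
  obtain ⟨y1, hy1⟩ : ∃ x, x = b1 + 3 := ⟨_, rfl⟩
  obtain ⟨y2, hy2⟩ : ∃ x, x = b2 - 3 := ⟨_, rfl⟩
  obtain ⟨z0, hz0⟩ : ∃ x, x = c0 - 4 := ⟨_, rfl⟩
  obtain ⟨z1, hz1⟩ : ∃ x, x = c1 - 3 := ⟨_, rfl⟩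
  rw [← hx0] at ha0
  rw [← hx1] at ha1
  rw [← hx2] at ha2
  rw [← hy0] at hb0
  rw [← hy1] at hb1
  rw [← hy2] at hb2
  rw [← hz0] at hc0
  rw [← hz1] at hc1
  rw [← ht] at hc2
  obtain rfl : a0 = x0 - 2 := by linarith
  obtain rfl : a1 = x1 + 2 := by linarith
  obtain rfl : a2 = x2 + 2 := by linarith
  obtain rfl : b0 = y0 + 3 := by linarith
  obtain rfl : b1 = y1 - 3 := by linarith
  obtain rfl : b2 = y2 + 3 := by linarith
  obtain rfl : c0 = z0 + 4 := by linarith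
  obtain rfl : c1 = z1 + 3 := by linarith
  obtain rfl : c2 = t - 1 := by linarith
  clear hx0 hx1 hx2 hy0 hy1 hy2 hz0 hz1 ht
  obtain ⟨G, hG⟩ : ∃ G, G = -(-6 * x0 + 15 * x1 + 21 * x2 + 8 * (y0 - t) - 6 * (y1 - t)
      + 14 * (y2 + t) + 12 * (z0 - 2 * t) + 12 * (z1 + t)) := ⟨_, rfl⟩
  have A0 : |x0| ≤ 100 * G := by rw [abs_le]; constructor <;> linarith only [hG, k0, k1, k2, k3, k4, k5, k6, k7, k8, k9, k10, k11, k12]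
  have A1 : |x1| ≤ 100 * G := by rw [abs_le]; constructor <;> linarith only [hG, k0, k1, k2, k3, k4, k5, k6, k7, k8, k9, k10, k11, k12]
  have A2 : |x2| ≤ 100 * G := by rw [abs_le]; constructor <;> linarith only [hG, k0, k1, k2, k3, k4, k5, k6, k7, k8, k9, k10, k11, k12]
  have A3 : |y0 - t| ≤ 100 * G := by rw [abs_le]; constructor <;> linarith only [hG, k0, k1, k2, k3, k4, k5, k6, k7, k8, k9, k10, k11, k12]
  have A4 : |y1 - t| ≤ 100 * G := by rw [abs_le]; constructor <;> linarith only [hG, k0, k1, k2, k3, k4, k5, k6, k7, k8, k9, k10, k11, k12]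
  have A5 : |y2 + t| ≤ 100 * G := by rw [abs_le]; constructor <;> linarith only [hG, k0, k1, k2, k3, k4, k5, k6, k7, k8, k9, k10, k11, k12]
  have A6 : |z0 - 2 * t| ≤ 100 * G := by rw [abs_le]; constructor <;> linarith only [hG, k0, k1, k2, k3, k4, k5, k6, k7, k8, k9, k10, k11, k12]
  have A7 : |z1 + t| ≤ 100 * G := by rw [abs_le]; constructor <;> linarith only [hG, k0, k1, k2, k3, k4, k5, k6, k7, k8, k9, k10, k11, k12]
  have P : ∀ {p q : ℝ}, |p| ≤ 1 / 1000000 → |q| ≤ 1 / 1000000 →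
      -(1 / 1000000) ≤ p * q ∧ p * q ≤ 1 / 1000000 := by
    intro p q hp hq
    rw [← abs_le, abs_mul]
    have := mul_le_mul hp hq (abs_nonneg q) (by norm_num)
    linarith
  have P1 := P hb1 hc2
  have P2 := P hb2 hc1
  have P3 := P hb2 hc0
  have P4 := P hb0 hc2
  have P5 := P hb0 hc1
  have P6 := P hb1 hc0
  have M : ∀ {p e : ℝ}, |p| ≤ 100 * G → |e| ≤ 1 / 10000 → p * e ≤ G / 100 := by
    intro p e hp he
    have h1 := mul_le_mul hp he (abs_nonneg e) (le_trans (abs_nonneg p) hp)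
    have h2 := le_abs_self (p * e)
    rw [abs_mul] at h2
    linarith
  have hG0 : 0 ≤ G := by have := abs_nonneg x0; linarith
  have ha0' := abs_le.1 ha0
  have ha1' := abs_le.1 ha1
  have ha2' := abs_le.1 ha2
  have hb0' := abs_le.1 hb0
  have hb1' := abs_le.1 hb1
  have hb2' := abs_le.1 hb2
  have hc0' := abs_le.1 hc0
  have hc1' := abs_le.1 hc1
  have hc2' := abs_le.1 hc2
  have M0 := M (e := (-3 * t - 3 * z1) + (-y1 - 3 * y2) + (y1 * t - y2 * z1)) A0
    (by rw [abs_le]; constructor <;> linarith only [ha0', ha1', ha2', hb0', hb1', hb2', hc0', hc1', hc2', P1, P2, P3, P4, P5, P6])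
  have M1 := M (e := (3 * z0 - 3 * t) + (4 * y2 + y0) + (y2 * z0 - y0 * t)) A1
    (by rw [abs_le]; constructor <;> linarith only [ha0', ha1', ha2', hb0', hb1', hb2', hc0', hc1', hc2', P1, P2, P3, P4, P5, P6])
  have M2 := M (e := (3 * z1 + 3 * z0) + (3 * y0 - 4 * y1) + (y0 * z1 - y1 * z0)) A2
    (by rw [abs_le]; constructor <;> linarith only [ha0', ha1', ha2', hb0', hb1', hb2', hc0', hc1', hc2', P1, P2, P3, P4, P5, P6])
  have M3 := M (e := 2 * z1 - 2 * t) A3 (by rw [abs_le]; constructor <;> linarith only [ha0', ha1', ha2', hb0', hb1', hb2', hc0', hc1', hc2', P1, P2, P3, P4, P5, P6])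
  have M4 := M (e := -2 * t - 2 * z0) A4 (by rw [abs_le]; constructor <;> linarith only [ha0', ha1', ha2', hb0', hb1', hb2', hc0', hc1', hc2', P1, P2, P3, P4, P5, P6])
  have M5 := M (e := 2 * z0 + 2 * z1) A5 (by rw [abs_le]; constructor <;> linarith only [ha0', ha1', ha2', hb0', hb1', hb2', hc0', hc1', hc2', P1, P2, P3, P4, P5, P6])
  have M6 := M (e := -4 * t) A6 (by rw [abs_le]; constructor <;> linarith only [ha0', ha1', ha2', hb0', hb1', hb2', hc0', hc1', hc2', P1, P2, P3, P4, P5, P6])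
  have M7 := M (e := 0 * t) A7 (by rw [abs_le]; constructor <;> linarith only [ha0', ha1', ha2', hb0', hb1', hb2', hc0', hc1', hc2', P1, P2, P3, P4, P5, P6])
  have hDe : D = 84 - G - 12 * t ^ 2
      + x0 * ((-3 * t - 3 * z1) + (-y1 - 3 * y2) + (y1 * t - y2 * z1))
      + x1 * ((3 * z0 - 3 * t) + (4 * y2 + y0) + (y2 * z0 - y0 * t))
      + x2 * ((3 * z1 + 3 * z0) + (3 * y0 - 4 * y1) + (y0 * z1 - y1 * z0))
      + (y0 - t) * (2 * z1 - 2 * t) + (y1 - t) * (-2 * t - 2 * z0)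
      + (y2 + t) * (2 * z0 + 2 * z1) + (z0 - 2 * t) * (-4 * t) + (z1 + t) * (0 * t) := by
    rw [hD, hG]; ring
  have hDle : D ≤ 84 - G / 2 - 12 * t ^ 2 := by
    linarith only [hDe, hG0, M0, M1, M2, M3, M4, M5, M6, M7]
  have hDpos : 0 ≤ D := by
    clear k0 k1 k2 k3 k4 k5 k6 k7 k8 k9 k10 k11 k12
    have hG1 : G ≤ 1 := by linarith
    have W : ∀ {p q : ℝ}, |p| ≤ 1 / 1000 → |q| ≤ 1 / 1000 → -1 ≤ p * q := by
      intro p q hp hq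
      have h1 := mul_le_mul hp hq (abs_nonneg q) (by norm_num)
      have h2 := neg_abs_le (p * q)
      rw [abs_mul] at h2
      linarith
    have T := P hc2 hc2
    have T' : t ^ 2 ≤ 1 := by rw [sq]; linarith
    have W0 := W (p := x0) (q := (-3 * t - 3 * z1) + (-y1 - 3 * y2) + (y1 * t - y2 * z1))
      (by rw [abs_le]; constructor <;> linarith only [ha0', ha1', ha2', hb0', hb1', hb2', hc0', hc1', hc2'])
      (by rw [abs_le]; constructor <;> linarith only [ha0', ha1', ha2', hb0', hb1', hb2', hc0', hc1', hc2', P1, P2, P3, P4, P5, P6])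
    have W1 := W (p := x1) (q := (3 * z0 - 3 * t) + (4 * y2 + y0) + (y2 * z0 - y0 * t))
      (by rw [abs_le]; constructor <;> linarith only [ha0', ha1', ha2', hb0', hb1', hb2', hc0', hc1', hc2'])
      (by rw [abs_le]; constructor <;> linarith only [ha0', ha1', ha2', hb0', hb1', hb2', hc0', hc1', hc2', P1, P2, P3, P4, P5, P6])
    have W2 := W (p := x2) (q := (3 * z1 + 3 * z0) + (3 * y0 - 4 * y1) + (y0 * z1 - y1 * z0))
      (by rw [abs_le]; constructor <;> linarith only [ha0', ha1', ha2', hb0', hb1', hb2', hc0', hc1', hc2'])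
      (by rw [abs_le]; constructor <;> linarith only [ha0', ha1', ha2', hb0', hb1', hb2', hc0', hc1', hc2', P1, P2, P3, P4, P5, P6])
    have W3 := W (p := y0 - t) (q := 2 * z1 - 2 * t)
      (by rw [abs_le]; constructor <;> linarith only [ha0', ha1', ha2', hb0', hb1', hb2', hc0', hc1', hc2'])
      (by rw [abs_le]; constructor <;> linarith only [ha0', ha1', ha2', hb0', hb1', hb2', hc0', hc1', hc2', P1, P2, P3, P4, P5, P6])
    have W4 := W (p := y1 - t) (q := -2 * t - 2 * z0)
      (by rw [abs_le]; constructor <;> linarith only [ha0', ha1', ha2', hb0', hb1', hb2', hc0', hc1', hc2'])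
      (by rw [abs_le]; constructor <;> linarith only [ha0', ha1', ha2', hb0', hb1', hb2', hc0', hc1', hc2', P1, P2, P3, P4, P5, P6])
    have W5 := W (p := y2 + t) (q := 2 * z0 + 2 * z1)
      (by rw [abs_le]; constructor <;> linarith only [ha0', ha1', ha2', hb0', hb1', hb2', hc0', hc1', hc2'])
      (by rw [abs_le]; constructor <;> linarith only [ha0', ha1', ha2', hb0', hb1', hb2', hc0', hc1', hc2', P1, P2, P3, P4, P5, P6])
    have W6 := W (p := z0 - 2 * t) (q := -4 * t)
      (by rw [abs_le]; constructor <;> linarith only [ha0', ha1', ha2', hb0', hb1', hb2', hc0', hc1', hc2'])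
      (by rw [abs_le]; constructor <;> linarith only [ha0', ha1', ha2', hb0', hb1', hb2', hc0', hc1', hc2', P1, P2, P3, P4, P5, P6])
    have W7 := W (p := z1 + t) (q := 0 * t)
      (by rw [abs_le]; constructor <;> linarith only [ha0', ha1', ha2', hb0', hb1', hb2', hc0', hc1', hc2'])
      (by rw [abs_le]; constructor <;> linarith only [ha0', ha1', ha2', hb0', hb1', hb2', hc0', hc1', hc2', P1, P2, P3, P4, P5, P6])
    linarith only [hDe, hG1, T', W0, W1, W2, W3, W4, W5, W6, W7]
  rw [abs_of_nonneg hDpos]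
  have ht2 := sq_nonneg t
  refine ⟨by linarith, fun h84 => ?_⟩
  have hGz : G = 0 := by linarith
  have ht0 : t = 0 := by
    have : t ^ 2 = 0 := by linarith
    simpa using this
  rw [hGz, mul_zero] at A0 A1 A2 A3 A4 A5 A6 A7
  have B0 := abs_nonpos_iff.1 A0
  have B1 := abs_nonpos_iff.1 A1
  have B2 := abs_nonpos_iff.1 A2
  have B3 := abs_nonpos_iff.1 A3
  have B4 := abs_nonpos_iff.1 A4
  have B5 := abs_nonpos_iff.1 A5
  have B6 := abs_nonpos_iff.1 A6
  have B7 := abs_nonpos_iff.1 A7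
  refine ⟨?_, ?_, ?_, ?_, ?_, ?_, ?_, ?_, ?_⟩ <;> linarith

end FL

/-- Forcade–Lamoreaux: The vectors `(−2,2,2)`, `(3,−3,3)`, `(4,3,−1)`
generate the lattice `L'_7`; the tetrahedra `T_{3,10} + L'_7` cover `ℝ³` and
`|det| = 84`. Moreover `L'_7` is locally optimal among lattices `L` with
`T_{3,10} + L = ℝ³`: for nearby generating triples giving such a covering, the
absolute determinant is at most `84`, with equality only for the original triple. -/
theorem stmt19 :
    (∀ y : Fin 3 → ℝ, ∃ b : Fin 3 → ℝ, (∀ i, 0 ≤ b i) ∧ (∑ i, b i) ≤ 10 ∧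
      y - b ∈ AddSubgroup.closure
        ({![(-2 : ℝ), 2, 2], ![3, -3, 3], ![4, 3, -1]} : Set (Fin 3 → ℝ))) ∧
    |(Matrix.of ![![(-2 : ℝ), 2, 2], ![3, -3, 3], ![4, 3, -1]]).det| = 84 ∧
    ∃ U ∈ nhds ((![(-2 : ℝ), 2, 2], ![3, -3, 3], ![4, 3, -1]) :
        (Fin 3 → ℝ) × (Fin 3 → ℝ) × (Fin 3 → ℝ)),
      ∀ w : (Fin 3 → ℝ) × (Fin 3 → ℝ) × (Fin 3 → ℝ), w ∈ U →
        (∀ y : Fin 3 → ℝ, ∃ b : Fin 3 → ℝ, (∀ i, 0 ≤ b i) ∧ (∑ i, b i) ≤ 10 ∧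
          y - b ∈ AddSubgroup.closure ({w.1, w.2.1, w.2.2} : Set (Fin 3 → ℝ))) →
        |(Matrix.of ![w.1, w.2.1, w.2.2]).det| ≤ 84 ∧
          (|(Matrix.of ![w.1, w.2.1, w.2.2]).det| = 84 →
            w = (![(-2 : ℝ), 2, 2], ![3, -3, 3], ![4, 3, -1])) := by
  refine ⟨FL.cover, ?_, Metric.closedBall _ (1 / 1000000),
    Metric.closedBall_mem_nhds _ (by norm_num), ?_⟩
  · rw [Matrix.det_fin_three]
    simp
    norm_num
  · rintro ⟨a, b, c⟩ hw hcov
    simp only at hcov ⊢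
    rw [Metric.mem_closedBall, Prod.dist_eq, Prod.dist_eq, max_le_iff, max_le_iff,
      dist_pi_le_iff (by norm_num), dist_pi_le_iff (by norm_num),
      dist_pi_le_iff (by norm_num)] at hw
    obtain ⟨ha, hb, hc⟩ := hw
    have ha0 := ha 0
    have ha1 := ha 1
    have ha2 := ha 2
    have hb0 := hb 0
    have hb1 := hb 1
    have hb2 := hb 2
    have hc0 := hc 0
    have hc1 := hc 1
    have hc2 := hc 2
    simp only [Real.dist_eq] at ha0 ha1 ha2 hb0 hb1 hb2 hc0 hc1 hc2
    have key := FL.opt (a0 := a 0) (a1 := a 1) (a2 := a 2) (b0 := b 0) (b1 := b 1) (b2 := b 2)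
      (c0 := c 0) (c1 := c 1) (c2 := c 2) (by simpa using ha0) (by simpa using ha1)
      (by simpa using ha2) (by simpa using hb0) (by simpa using hb1) (by simpa using hb2)
      (by simpa using hc0) (by simpa using hc1) (by simpa using hc2) ?_
      (Matrix.of ![a, b, c]).det ?_
    · refine ⟨key.1, fun h => ?_⟩
      obtain ⟨e0, e1, e2, e3, e4, e5, e6, e7, e8⟩ := key.2 h
      refine Prod.ext ?_ (Prod.ext ?_ ?_)
      · ext i
        fin_cases i <;> simp [e0, e1, e2]
      · ext i
        fin_cases i <;> simp [e3, e4, e5]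
      · ext i
        fin_cases i <;> simp [e6, e7, e8]
    · intro y0 y1 y2
      obtain ⟨v, hv, hs, hm⟩ := hcov ![y0, y1, y2]
      rw [FL.mem_iff] at hm
      obtain ⟨n, m, k, h⟩ := hm
      refine ⟨n, m, k, ?_⟩
      have h0 := h 0
      have h1 := h 1
      have h2 := h 2
      have v0 := hv 0
      have v1 := hv 1
      have v2 := hv 2
      rw [Fin.sum_univ_three] at hs
      simp at h0 h1 h2
      refine ⟨?_, ?_, ?_, ?_⟩ <;> linarith
    · rw [Matrix.det_fin_three]
      simp
      ring
end
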